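/- arXiv:2201.12777 — 3 statements merged into one kernel-verified Lean document; each statement's English description precedes it below -/
import Mathlib

section
/- Let s and n be coprime positive integers with 1 ≤ s < n/2, and let θ, δ ∈ F_{q^n}^* satisfy N_{q^n/q}(θ) ≠ 1 and N_{q^n/q}(δ) ≠ 1. Set f(x) = x^{q^s} + θ·x^{q^{n−s}} and g(x) = x^{q^s} + δ·x^{q^{n−s}}. Then there exists d ∈ F_{q^n} with {f(x)/x : x ∈ F_{q^n}^*} = {d·g(x)/x : x ∈ F_{q^n}^*} if and only if: N_{q^n/q}(θ) ∈ {N_{q^n/q}(δ), N_{q^n/q}(δ)^{−1}} when n is odd, and N_{q^n/q²}(θ) ∈ {N_{q^n/q²}(δ), (N_{q^n/q²}(δ)^{−1})^{q^s}} when n is even. -/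
open Finset

/-- digit uniqueness, indexed by `ZMod n` -/
theorem LPaux_digits (q n : ℕ) [NeZero n] (c : ZMod n → ℕ) (hc : ∀ j, c j < q) :
    ∑ j, c j * q ^ j.val < q ^ n ∧
    ∀ b : ZMod n → ℕ, (∀ j, b j < q) → ∑ j, c j * q ^ j.val = ∑ j, b j * q ^ j.val → c = b := by
  obtain ⟨m, rfl⟩ : ∃ m, n = m + 1 := ⟨n - 1, by have := NeZero.ne n; omega⟩
  have key : ∀ b : ZMod (m+1) → ℕ, ∀ hb : (∀ j, b j < q), ∑ j, b j * q ^ j.val =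
      (finFunctionFinEquiv (fun j : Fin (m+1) => (⟨b j, hb j⟩ : Fin q)) : ℕ) := by
    intro b hb
    rw [finFunctionFinEquiv_apply]
    rfl
  constructor
  · rw [key c hc]; exact Fin.is_lt _
  · intro b hb h
    rw [key c hc, key b hb] at h
    have := finFunctionFinEquiv.injective (Fin.ext h)
    funext j
    have := congrFun this j
    simpa using this

/-- The conjugation `x ↦ x^{q^j}` indexed by `ZMod n`. -/
def LPFr {F : Type*} [Field F] (q : ℕ) {n : ℕ} (j : ZMod n) (x : F) : F := x ^ q ^ j.val

section
set_option linter.unusedSectionVars false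
variable {F : Type*} [Field F] [Fintype F] {q n : ℕ} [NeZero n]

theorem LPFr_pow (hF : Fintype.card F = q ^ n) (m : ℕ) (x : F) :
    x ^ q ^ m = LPFr q (m : ZMod n) x := by
  unfold LPFr
  rw [ZMod.val_natCast]
  conv_lhs => rw [← Nat.div_add_mod m n, pow_add, pow_mul q, pow_mul x, ← hF,
    FiniteField.pow_card_pow]

theorem LPFr_comp (hF : Fintype.card F = q ^ n) (i j : ZMod n) (x : F) :
    LPFr q i (LPFr q j x) = LPFr q (i + j) x := by
  have : i + j = ((j.val + i.val : ℕ) : ZMod n) := by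
    push_cast; simp [add_comm]
  rw [this, ← LPFr_pow hF, pow_add, pow_mul]; rfl

theorem LPFr_mul (j : ZMod n) (x y : F) : LPFr q j (x * y) = LPFr q j x * LPFr q j y :=
  mul_pow _ _ _

theorem LPFr_div (j : ZMod n) (x y : F) : LPFr q j (x / y) = LPFr q j x / LPFr q j y :=
  div_pow _ _ _

theorem LPFr_zero (x : F) : LPFr q (0 : ZMod n) x = x := by simp [LPFr]

theorem LPFr_ne_zero (j : ZMod n) {x : F} (hx : x ≠ 0) : LPFr q j x ≠ 0 := pow_ne_zero _ hx

theorem LPFr_add {p r : ℕ} [Fact p.Prime] [CharP F p] (hq : q = p ^ r) (j : ZMod n) (x y : F) :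
    LPFr q j (x + y) = LPFr q j x + LPFr q j y := by
  unfold LPFr
  rw [hq, ← pow_mul, add_pow_char_pow]

/-- power sums of monomials -/
theorem LPsum (hF : Fintype.card F = q ^ n) (c b : ZMod n → ℕ)
    (hc : ∀ j, c j < q) (hb : ∀ j, b j < q) (hc0 : c ≠ 0) (hb0 : b ≠ 0) [Decidable (c = b)] [DecidableEq F] :
    ∑ x : Fˣ, (∏ j, LPFr q j (x : F) ^ c j) / (∏ j, LPFr q j (x : F) ^ b j) =
      if c = b then (-1 : F) else 0 := by
  have hq0 : 0 < q := lt_of_le_of_lt (Nat.zero_le _) (hc 0)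
  have hpow : ∀ c : ZMod n → ℕ, ∀ x : F, ∏ j, LPFr q j x ^ c j = x ^ (∑ j, c j * q ^ j.val) := by
    intro c x
    rw [← Finset.prod_pow_eq_pow_sum]
    refine Finset.prod_congr rfl fun j _ => ?_
    rw [LPFr, ← pow_mul, mul_comm]
  have hpos : ∀ c : ZMod n → ℕ, c ≠ 0 → 0 < ∑ j, c j * q ^ j.val := by
    intro c h
    obtain ⟨j, hj⟩ := Function.ne_iff.1 h
    refine Finset.sum_pos' (fun _ _ => Nat.zero_le _) ⟨j, mem_univ _, ?_⟩
    have : 0 < c j := Nat.pos_of_ne_zero hj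
    positivity
  obtain ⟨hC, hinj⟩ := LPaux_digits q n c hc
  obtain ⟨hB, -⟩ := LPaux_digits q n b hb
  have hC0 := hpos c hc0
  have hB0 := hpos b hb0
  have hinj := hinj b hb
  simp_rw [hpow]
  have hcb : c = b ↔ ∑ j, c j * q ^ j.val = ∑ j, b j * q ^ j.val := ⟨fun h => by rw [h], hinj⟩
  clear hinj
  generalize ∑ j, c j * q ^ j.val = C at *
  generalize ∑ j, b j * q ^ j.val = B at *
  have h1 : ∀ x : Fˣ, (x : F) ^ C / (x : F) ^ B = (x : F) ^ (C + (q ^ n - 1 - B)) := by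
    intro x
    have hx : (x : F) ^ (q ^ n - 1) = 1 := by
      rw [← hF]; exact FiniteField.pow_card_sub_one_eq_one _ x.ne_zero
    rw [div_eq_iff (pow_ne_zero _ x.ne_zero), ← pow_add]
    have : C + (q ^ n - 1 - B) + B = C + (q ^ n - 1) := by omega
    rw [this, pow_add, hx, mul_one]
  simp_rw [h1]
  rw [FiniteField.sum_pow_units, hF]
  congr 1
  rw [hcb, eq_iff_iff]
  constructor
  · rintro ⟨k, hk⟩
    have : k = 1 := by
      rcases k with _ | _ | k
      · omega
      · rfl
      · exfalso
        have : (q ^ n - 1) * 2 ≤ (q ^ n - 1) * (k + 1 + 1) := Nat.mul_le_mul_left _ (by omega)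
        omega
    subst this; omega
  · rintro rfl
    exact ⟨1, by omega⟩

/-- Sums over a linear set. -/
theorem LPsum_linset {p r : ℕ} [Fact p.Prime] [CharP F p] (hF : Fintype.card F = p ^ r)
    (h : F →+ F) (φ : F → F) [DecidableEq F] :
    ∑ x : Fˣ, φ (h x / x) = - ∑ y ∈ Finset.univ.image (fun x : Fˣ => h x / x), φ y := by
  rw [Finset.sum_comp (f := φ) (g := fun x : Fˣ => h x / x), ← Finset.sum_neg_distrib]
  refine Finset.sum_congr rfl fun y hy => ?_
  obtain ⟨x0, -, hx0⟩ := Finset.mem_image.1 hy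
  let K : AddSubgroup F := (h - AddMonoidHom.mulLeft y).ker
  have hK : ∀ x, x ∈ K ↔ h x = y * x := by
    intro x; simp [K, AddMonoidHom.mem_ker, sub_eq_zero]
  have hcard : Nat.card K = #{a : Fˣ | h (a : F) / (a : F) = y} + 1 := by
    have e : (univ.filter fun x : F => x ∈ K) =
        insert 0 ((univ.filter fun a : Fˣ => h (a : F) / (a : F) = y).map ⟨Units.val, Units.val_injective⟩) := by
      ext x
      simp only [mem_filter, mem_univ, true_and, mem_insert, mem_map, Function.Embedding.coeFn_mk, hK]
      constructor
      · intro hx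
        by_cases h0 : x = 0
        · exact Or.inl h0
        · refine Or.inr ⟨Units.mk0 x h0, ?_, rfl⟩
          simp [hx, h0]
      · rintro (rfl | ⟨a, ha, rfl⟩)
        · simp
        · rwa [div_eq_iff a.ne_zero] at ha
    have : Nat.card K = #(univ.filter fun x : F => x ∈ K) := by
      rw [Nat.card_eq_fintype_card, Fintype.card_subtype]
    rw [this, e, Finset.card_insert_of_notMem, Finset.card_map]
    simp
  have hdvd : p ∣ Nat.card K := by
    have h1 := AddSubgroup.card_addSubgroup_dvd_card K
    rw [Nat.card_eq_fintype_card (α := F), hF, Nat.dvd_prime_pow Fact.out] at h1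
    obtain ⟨k, -, hk⟩ := h1
    rcases k with _ | k
    · exfalso
      rw [hcard, pow_zero] at hk
      have : 0 < #{a : Fˣ | h (a : F) / (a : F) = y} := Finset.card_pos.2 ⟨x0, by simpa using hx0⟩
      omega
    · rw [hk, pow_succ]; exact dvd_mul_left _ _
  have : ((#{a : Fˣ | h (a : F) / (a : F) = y} + 1 : ℕ) : F) = 0 := by
    rw [← hcard]; exact (CharP.cast_eq_zero_iff F p _).2 hdvd
  rw [nsmul_eq_mul]
  push_cast at this
  rw [eq_neg_of_add_eq_zero_left this]; ring

theorem LPFr_prod {ι : Type*} (u : ZMod n) (t : Finset ι) (g : ι → F) :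
    LPFr q u (∏ i ∈ t, g i) = ∏ i ∈ t, LPFr q u (g i) := by
  unfold LPFr; rw [Finset.prod_pow]

theorem LPsum2 [DecidableEq F] (hF : Fintype.card F = q ^ n) (hq3 : 3 ≤ q) (i j k l : ZMod n) :
    ∑ x : Fˣ, (LPFr q i (x : F) * LPFr q j (x : F)) / (LPFr q k (x : F) * LPFr q l (x : F)) =
      if (Pi.single i 1 + Pi.single j 1 : ZMod n → ℕ) = Pi.single k 1 + Pi.single l 1
        then (-1 : F) else 0 := by
  classical
  have hlt : ∀ i j : ZMod n, ∀ m, (Pi.single i 1 + Pi.single j 1 : ZMod n → ℕ) m < q := by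
    intro i j m
    simp only [Pi.add_apply, Pi.single_apply]
    split_ifs <;> omega
  have hne : ∀ i j : ZMod n, (Pi.single i 1 + Pi.single j 1 : ZMod n → ℕ) ≠ 0 := by
    intro i j h
    have := congrFun h i
    simp at this
  have hprod : ∀ i j : ZMod n, ∀ x : F,
      ∏ m, LPFr q m x ^ (Pi.single i 1 + Pi.single j 1 : ZMod n → ℕ) m
        = LPFr q i x * LPFr q j x := by
    intro i j x
    simp only [Pi.add_apply, pow_add, Finset.prod_mul_distrib]
    congr 1 <;> simp [Pi.single_apply, pow_ite]
  have := LPsum (F := F) hF _ _ (hlt i j) (hlt k l) (hne i j) (hne k l)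
  simp_rw [hprod] at this
  exact this

theorem LPrel1 {p r : ℕ} [Fact p.Prime] [CharP F p] (hq : q = p ^ r) [DecidableEq F]
    (hF : Fintype.card F = q ^ n) (hq3 : 3 ≤ q)
    (u : ZMod n) (hu : u ≠ 0) (hu2 : u + u ≠ 0) (θ : F) :
    ∑ x : Fˣ, ((LPFr q u (x : F) + θ * LPFr q (-u) (x : F)) / x) *
      LPFr q u ((LPFr q u (x : F) + θ * LPFr q (-u) (x : F)) / x) = - LPFr q u θ := by
  have hnu : -u ≠ u := fun h => hu2 (by nth_rewrite 1 [← h]; simp)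
  have h1 := LPsum2 (F := F) hF hq3 (u+u) u 0 u
  have h2 := LPsum2 (F := F) hF hq3 0 u 0 u
  have h3 := LPsum2 (F := F) hF hq3 (u+u) (-u) 0 u
  have h4 := LPsum2 (F := F) hF hq3 (-u) 0 0 u
  rw [if_neg] at h1 h3 h4
  rotate_left
  · intro h; have := congrFun h (-u); simp [Pi.single_apply, hu, hnu] at this
  · intro h; have := congrFun h (u+u); simp [Pi.single_apply, hu2, hu] at this
  · intro h; have := congrFun h (u+u); simp [Pi.single_apply, hu2, hu] at this
  rw [if_pos rfl] at h2
  have e : ∀ x : Fˣ, ((LPFr q u (x : F) + θ * LPFr q (-u) (x : F)) / x) *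
      LPFr q u ((LPFr q u (x : F) + θ * LPFr q (-u) (x : F)) / x) =
      (LPFr q (u+u) (x : F) * LPFr q u (x : F)) / (LPFr q (0 : ZMod n) (x : F) * LPFr q u (x : F))
      + LPFr q u θ * ((LPFr q (0 : ZMod n) (x : F) * LPFr q u (x : F)) / (LPFr q (0 : ZMod n) (x : F) * LPFr q u (x : F)))
      + θ * ((LPFr q (u+u) (x : F) * LPFr q (-u) (x : F)) / (LPFr q (0 : ZMod n) (x : F) * LPFr q u (x : F)))
      + θ * LPFr q u θ * ((LPFr q (-u) (x : F) * LPFr q (0 : ZMod n) (x : F)) / (LPFr q (0 : ZMod n) (x : F) * LPFr q u (x : F))) := by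
    intro x
    rw [LPFr_div, LPFr_add hq, LPFr_mul, LPFr_comp hF, LPFr_comp hF, add_neg_cancel, LPFr_zero]
    ring
  simp_rw [e, Finset.sum_add_distrib, ← Finset.mul_sum]
  rw [h1, h2, h3, h4]; ring

theorem LPrel2 {p r : ℕ} [Fact p.Prime] [CharP F p] (hq : q = p ^ r) [DecidableEq F]
    (hF : Fintype.card F = q ^ n) (hq3 : 3 ≤ q) (u : ZMod n) (θ : F) :
    ∑ x : Fˣ, ∏ j : ZMod n, LPFr q j ((LPFr q u (x : F) + θ * LPFr q (-u) (x : F)) / x) =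
      - ∑ t ∈ Finset.univ.filter (fun t : Finset (ZMod n) => ∀ j, j ∈ t ↔ j + 2 * u ∈ t),
          ∏ j ∈ tᶜ, LPFr q j θ := by
  let c : Finset (ZMod n) → ZMod n → ℕ := fun t j =>
    (if j - u ∈ t then 1 else 0) + (if j + u ∈ t then 0 else 1)
  have hc : ∀ t j, c t j < q := by
    intro t j; simp only [c]; split_ifs <;> omega
  have hc0 : ∀ t, c t ≠ 0 := by
    intro t h
    have h1 := congrFun h u
    have h2 := congrFun h (-u)
    simp [c] at h1 h2
    exact h1.1 h2.2
  have hone : ∀ j : ZMod n, (1 : ZMod n → ℕ) j < q := by intro j; simp; omega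
  have hone0 : (1 : ZMod n → ℕ) ≠ 0 := one_ne_zero
  have hc1 : ∀ t, c t = 1 ↔ ∀ j, j ∈ t ↔ j + 2 * u ∈ t := by
    intro t
    constructor
    · intro h j
      have := congrFun h (j + u)
      simp only [c, Pi.one_apply, add_sub_cancel_right] at this
      have e : j + u + u = j + 2 * u := by ring
      rw [e] at this
      split_ifs at this <;> simp_all
    · intro h
      funext j
      have := h (j - u)
      have e : j - u + 2 * u = j + u := by ring
      rw [e] at this
      simp only [c, this, Pi.one_apply]
      split_ifs <;> simp
  have hmon : ∀ t, ∀ x : F, (∏ j ∈ t, LPFr q (j + u) x) * ∏ j ∈ tᶜ, LPFr q (j - u) x =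
      ∏ j, LPFr q j x ^ c t j := by
    intro t x
    simp only [c, pow_add, Finset.prod_mul_distrib]
    congr 1
    · rw [← Equiv.prod_comp (Equiv.addRight u)]
      simp [pow_ite, Finset.prod_ite]
    · rw [← Equiv.prod_comp (Equiv.subRight u)]
      simp only [Equiv.subRight_apply, sub_add_cancel, pow_ite, pow_zero, pow_one]
      rw [Finset.prod_ite, Finset.prod_const_one, one_mul]
      refine Finset.prod_congr ?_ fun _ _ => rfl
      ext j; simp
  have e : ∀ x : Fˣ, ∏ j : ZMod n, LPFr q j ((LPFr q u (x : F) + θ * LPFr q (-u) (x : F)) / x) =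
      ∑ t : Finset (ZMod n), (∏ j ∈ tᶜ, LPFr q j θ) *
        ((∏ j, LPFr q j (x : F) ^ c t j) / ∏ j, LPFr q j (x : F) ^ ((1 : ZMod n → ℕ) j)) := by
    intro x
    simp_rw [LPFr_div, LPFr_add hq, LPFr_mul, LPFr_comp hF, ← sub_eq_add_neg]
    rw [Finset.prod_div_distrib, Fintype.prod_add, Finset.sum_div]
    refine Finset.sum_congr rfl fun t _ => ?_
    rw [← hmon, Finset.prod_mul_distrib]
    simp only [Pi.one_apply, pow_one]
    ring
  simp_rw [e]
  rw [Finset.sum_comm]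
  simp_rw [← Finset.mul_sum]
  rw [Finset.sum_filter, ← Finset.sum_neg_distrib]
  refine Finset.sum_congr rfl fun t _ => ?_
  rw [LPsum hF (c t) 1 (hc t) hone (hc0 t) hone0]
  simp only [hc1]
  split_ifs <;> simp

theorem LPinv_mul (t : Finset (ZMod n)) (v : ZMod n) (h : ∀ j, j ∈ t ↔ j + v ∈ t) (w : ℕ)
    (j : ZMod n) : j ∈ t ↔ j + w * v ∈ t := by
  induction w with
  | zero => simp
  | succ w ih =>
    rw [ih, h]; push_cast; ring_nf

theorem LPclass_odd (u : ZMod n) (hu : IsUnit u) (hn : Odd n) :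
    Finset.univ.filter (fun t : Finset (ZMod n) => ∀ j, j ∈ t ↔ j + 2 * u ∈ t) = {∅, univ} := by
  have h2 : IsUnit (2 : ZMod n) := by
    have := (ZMod.isUnit_iff_coprime 2 n).2 (by simpa using hn)
    simpa using this
  obtain ⟨v, hv⟩ := (h2.mul hu).exists_left_inv
  ext t
  simp only [mem_filter, mem_univ, true_and, mem_insert, mem_singleton]
  constructor
  · intro h
    by_cases h0 : (0 : ZMod n) ∈ t
    · right; ext k
      have := LPinv_mul t _ h (k * v).val 0
      simp only [ZMod.natCast_val, ZMod.cast_id', id, mul_assoc, hv, mul_one, zero_add] at this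
      simp [← this, h0]
    · left; ext k
      have := LPinv_mul t _ h (k * v).val 0
      simp only [ZMod.natCast_val, ZMod.cast_id', id, mul_assoc, hv, mul_one, zero_add] at this
      simp [← this, h0]
  · rintro (rfl | rfl) <;> simp

/-- The even residues. -/
def LPE (n : ℕ) [NeZero n] : Finset (ZMod n) := Finset.univ.filter fun j => Even j.val

theorem LPval_add (hn : Even n) (i j : ZMod n) : Even (i + j).val ↔ (Even i.val ↔ Even j.val) := by
  rw [ZMod.val_add, Nat.even_iff, Nat.mod_mod_of_dvd _ hn.two_dvd, ← Nat.even_iff, Nat.even_add]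

theorem LPclass_even (u : ZMod n) (hu : IsUnit u) (hn : Even n) :
    Finset.univ.filter (fun t : Finset (ZMod n) => ∀ j, j ∈ t ↔ j + 2 * u ∈ t) =
      {∅, univ, LPE n, (LPE n)ᶜ} := by
  obtain ⟨v, hv⟩ := hu.exists_left_inv
  have hnn := NeZero.ne n
  have hn2 : 2 ≤ n := by obtain ⟨m, rfl⟩ := hn; omega
  have h1v : ¬ Even (1 : ZMod n).val := by
    have : Fact (1 < n) := ⟨by omega⟩
    rw [ZMod.val_one]; decide
  ext t
  simp only [mem_filter, mem_univ, true_and, mem_insert, mem_singleton]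
  constructor
  · intro h
    have hk : ∀ (k : ℕ) (j : ZMod n), j ∈ t ↔ j + k * 2 ∈ t := by
      intro k j
      have := LPinv_mul t _ h (k * v).val j
      have e : (k : ZMod n) * v * (2 * u) = k * 2 * (v * u) := by ring
      simp only [ZMod.natCast_val, ZMod.cast_id', id, e, hv, mul_one] at this
      exact this
    have hE : ∀ j : ZMod n, Even j.val → (j ∈ t ↔ (0 : ZMod n) ∈ t) := by
      intro j hj
      obtain ⟨k, hk'⟩ := hj
      rw [hk k 0]
      have : j = 0 + k * 2 := by
        rw [← ZMod.natCast_zmod_val j, hk']; push_cast; ring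
      rw [← this]
    have hO : ∀ j : ZMod n, ¬ Even j.val → (j ∈ t ↔ (1 : ZMod n) ∈ t) := by
      intro j hj
      obtain ⟨k, hk'⟩ := Nat.not_even_iff_odd.1 hj
      rw [hk k 1]
      have : j = 1 + k * 2 := by
        rw [← ZMod.natCast_zmod_val j, hk']; push_cast; ring
      rw [← this]
    by_cases h0 : (0 : ZMod n) ∈ t <;> by_cases h1 : (1 : ZMod n) ∈ t
    · right; left; ext j
      by_cases hj : Even j.val
      · simp [hE j hj, h0]
      · simp [hO j hj, h1]
    · right; right; left; ext j
      by_cases hj : Even j.val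
      · simp [hE j hj, h0, LPE, hj]
      · simp [hO j hj, h1, LPE, hj]
    · right; right; right; ext j
      by_cases hj : Even j.val
      · simp [hE j hj, h0, LPE, hj]
      · simp [hO j hj, h1, LPE, Nat.not_even_iff_odd.1 hj]
    · left; ext j
      by_cases hj : Even j.val
      · simp [hE j hj, h0]
      · simp [hO j hj, h1]
  · have h2 : ∀ j : ZMod n, Even (j + 2 * u).val ↔ Even j.val := by
      intro j
      rw [two_mul, LPval_add hn, LPval_add hn]; tauto
    rintro (rfl | rfl | rfl | rfl) <;> simp [LPE, h2, ← Nat.not_even_iff_odd]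

theorem LPnorm (hq2 : 2 ≤ q) (y : F) : ∏ j : ZMod n, LPFr q j y = y ^ ((q ^ n - 1) / (q - 1)) := by
  unfold LPFr
  rw [Finset.prod_pow_eq_pow_sum, ← Nat.geomSum_eq hq2]
  congr 1
  obtain ⟨m, rfl⟩ : ∃ m, n = m + 1 := ⟨n - 1, by have := NeZero.ne n; omega⟩
  exact Fin.sum_univ_eq_sum_range (fun i => q ^ i) (m + 1)

theorem LPnorm2 (hq2 : 2 ≤ q) (hn : Even n) (y : F) :
    ∏ j ∈ LPE n, LPFr q j y = y ^ ((q ^ n - 1) / (q ^ 2 - 1)) := by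
  unfold LPFr LPE
  rw [Finset.prod_pow_eq_pow_sum, Finset.sum_filter]
  congr 1
  have h1 : ∑ j : ZMod n, (if Even j.val then q ^ j.val else 0) =
      ∑ i ∈ range n, if Even i then q ^ i else 0 := by
    obtain ⟨m, rfl⟩ : ∃ m, n = m + 1 := ⟨n - 1, by have := NeZero.ne n; omega⟩
    exact Fin.sum_univ_eq_sum_range (fun i => if Even i then q ^ i else 0) (m + 1)
  rw [h1]
  obtain ⟨m, rfl⟩ := hn
  have h2 : q ^ (m + m) = (q ^ 2) ^ m := by rw [← pow_mul]; congr 1; omega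
  rw [h2, ← Nat.geomSum_eq (by nlinarith)]
  clear h1 h2
  induction m with
  | zero => simp
  | succ m ih =>
    have : m + 1 + (m + 1) = m + m + 1 + 1 := by omega
    rw [this, Finset.sum_range_succ, Finset.sum_range_succ, Finset.sum_range_succ]
    have ih' : ∑ i ∈ range (m + m), (if Even i then q ^ i else 0) = ∑ k ∈ range m, (q ^ 2) ^ k := by
      rcases Nat.eq_zero_or_pos m with rfl | hm
      · simp
      · have : NeZero (m + m) := ⟨by omega⟩
        exact ih
    rw [ih', if_pos ⟨m, rfl⟩, if_neg (by simp [Nat.even_add_one]), ← pow_mul, two_mul, add_zero]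

theorem LPprod_shift (hF : Fintype.card F = q ^ n) (t t' : Finset (ZMod n)) (u : ZMod n)
    (h : ∀ j, j ∈ t ↔ j + u ∈ t') (y : F) :
    ∏ j ∈ t, LPFr q j (LPFr q u y) = ∏ j ∈ t', LPFr q j y := by
  simp_rw [LPFr_comp hF]
  exact Finset.prod_equiv (Equiv.addRight u) (by simpa using h) (fun _ _ => rfl)

theorem LPsumset_odd (hn : Odd n) (hq2 : 2 ≤ q) (u : ZMod n) (hu : IsUnit u) (θ : F) :
    ∑ t ∈ Finset.univ.filter (fun t : Finset (ZMod n) => ∀ j, j ∈ t ↔ j + 2 * u ∈ t),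
          ∏ j ∈ tᶜ, LPFr q j θ = θ ^ ((q ^ n - 1) / (q - 1)) + 1 := by
  rw [LPclass_odd u hu hn, Finset.sum_insert, Finset.sum_singleton]
  · simp [LPnorm hq2]
  · simp only [mem_singleton]; exact Finset.univ_nonempty.ne_empty.symm

theorem LPsumset_even (hn : Even n) (hq2 : 2 ≤ q) (u : ZMod n) (hu : IsUnit u) (θ : F) :
    ∑ t ∈ Finset.univ.filter (fun t : Finset (ZMod n) => ∀ j, j ∈ t ↔ j + 2 * u ∈ t),
          ∏ j ∈ tᶜ, LPFr q j θ =
      (1 + ∏ j ∈ LPE n, LPFr q j θ) * (1 + ∏ j ∈ (LPE n)ᶜ, LPFr q j θ) := by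
  have hnn := NeZero.ne n
  have : Fact (1 < n) := ⟨by obtain ⟨m, rfl⟩ := hn; omega⟩
  have h1 : (1 : ZMod n) ∉ LPE n := by simp [LPE, ZMod.val_one]
  have h0 : (0 : ZMod n) ∈ LPE n := by simp [LPE]
  rw [LPclass_even u hu hn, Finset.sum_insert, Finset.sum_insert, Finset.sum_insert,
    Finset.sum_singleton]
  · simp only [compl_empty, compl_univ, prod_empty, compl_compl]
    rw [← Finset.prod_mul_prod_compl (LPE n)]
    ring
  · simp only [mem_singleton]
    intro h
    rw [h] at h0
    simp [LPE] at h0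
  · simp only [mem_insert, mem_singleton, not_or]
    constructor
    · intro h; rw [← h] at h1; simp at h1
    · intro h
      have := mem_univ (0 : ZMod n)
      rw [h] at this
      exact (mem_compl.1 this) h0
  · simp only [mem_insert, mem_singleton, not_or]
    refine ⟨Finset.univ_nonempty.ne_empty.symm, ?_, ?_⟩
    · intro h; rw [← h] at h0; simp at h0
    · intro h
      have := mem_compl.2 h1
      rw [← h] at this; simp at this

/-- Equal linear sets give equal sums. -/
theorem LPsets {p r : ℕ} [Fact p.Prime] [CharP F p] (hr : Fintype.card F = p ^ r)
    [DecidableEq F] (f g : F → F) (hf : ∀ x y, f (x + y) = f x + f y)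
    (hg : ∀ x y, g (x + y) = g x + g y) (d : F)
    (h : {y : F | ∃ x : F, x ≠ 0 ∧ y = f x / x} = {y : F | ∃ x : F, x ≠ 0 ∧ y = d * g x / x})
    (φ : F → F) : ∑ x : Fˣ, φ (f x / x) = ∑ x : Fˣ, φ (d * (g x / x)) := by
  have h1 := LPsum_linset hr (AddMonoidHom.mk' f hf) φ
  have h2 := LPsum_linset hr (AddMonoidHom.mk' (fun x => d * g x)
    (fun x y => by rw [hg, mul_add])) φ
  simp only [AddMonoidHom.mk'_apply] at h1 h2
  simp_rw [← mul_div_assoc]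
  rw [h1, h2]
  congr 2
  ext y
  have := Set.ext_iff.1 h y
  simp only [Set.mem_ofPred_eq] at this
  simp only [mem_image, mem_univ, true_and]
  constructor
  · rintro ⟨x, rfl⟩
    obtain ⟨z, hz, e⟩ := this.1 ⟨x, x.ne_zero, rfl⟩
    exact ⟨Units.mk0 z hz, e.symm⟩
  · rintro ⟨x, rfl⟩
    obtain ⟨z, hz, e⟩ := this.2 ⟨x, x.ne_zero, rfl⟩
    exact ⟨Units.mk0 z hz, e.symm⟩

theorem LPforward {p r : ℕ} [Fact p.Prime] [CharP F p] (hq : q = p ^ r)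
    (hF : Fintype.card F = q ^ n) (hq3 : 3 ≤ q)
    (u : ZMod n) (hu : u ≠ 0) (hu2 : u + u ≠ 0) (huu : IsUnit u) (θ δ : F) (hδ0 : δ ≠ 0) (d : F)
    (h : {y : F | ∃ x : F, x ≠ 0 ∧ y = (LPFr q u x + θ * LPFr q (-u) x) / x} =
      {y : F | ∃ x : F, x ≠ 0 ∧ y = d * (LPFr q u x + δ * LPFr q (-u) x) / x}) :
    (Odd n ∧
        (θ ^ ((q ^ n - 1) / (q - 1)) = δ ^ ((q ^ n - 1) / (q - 1)) ∨
         θ ^ ((q ^ n - 1) / (q - 1)) = (δ ^ ((q ^ n - 1) / (q - 1)))⁻¹)) ∨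
     (Even n ∧
        (θ ^ ((q ^ n - 1) / (q ^ 2 - 1)) = δ ^ ((q ^ n - 1) / (q ^ 2 - 1)) ∨
         θ ^ ((q ^ n - 1) / (q ^ 2 - 1)) =
          LPFr q u ((δ ^ ((q ^ n - 1) / (q ^ 2 - 1)))⁻¹))) := by
  classical
  have hq2 : 2 ≤ q := by omega
  have hadd : ∀ θ x y : F, LPFr q u (x + y) + θ * LPFr q (-u) (x + y) =
      LPFr q u x + θ * LPFr q (-u) x + (LPFr q u y + θ * LPFr q (-u) y) := by
    intro θ x y; rw [LPFr_add hq, LPFr_add hq]; ring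
  have hcard : Fintype.card F = p ^ (r * n) := by rw [hF, hq, pow_mul]
  have key := LPsets hcard (fun x => LPFr q u x + θ * LPFr q (-u) x)
    (fun x => LPFr q u x + δ * LPFr q (-u) x) (hadd θ) (hadd δ) d h
  have k1 := key (fun y => y * LPFr q u y)
  have k2 := key (fun y => ∏ j : ZMod n, LPFr q j y)
  rw [LPrel1 hq hF hq3 u hu hu2] at k1
  rw [LPrel2 hq hF hq3 u] at k2
  simp_rw [LPFr_mul, mul_mul_mul_comm d] at k1
  rw [← Finset.mul_sum, LPrel1 hq hF hq3 u hu hu2] at k1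
  simp_rw [LPFr_mul, Finset.prod_mul_distrib] at k2
  rw [← Finset.mul_sum, LPrel2 hq hF hq3 u] at k2
  have k1' : LPFr q u θ = d * LPFr q u d * LPFr q u δ := by linear_combination -k1
  rcases Nat.even_or_odd n with hn | hn
  · right
    refine ⟨hn, ?_⟩
    rw [LPsumset_even hn hq2 u huu, LPsumset_even hn hq2 u huu] at k2
    have huo : ¬ Even u.val := by
      intro he
      have := (ZMod.isUnit_iff_coprime u.val n).1 (by simpa using huu)
      have h2 := Nat.dvd_gcd he.two_dvd hn.two_dvd
      rw [this] at h2; omega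
    have s1 : ∀ y : F, ∏ j ∈ LPE n, LPFr q j (LPFr q u y) = ∏ j ∈ (LPE n)ᶜ, LPFr q j y := by
      intro y
      apply LPprod_shift hF
      intro j; rw [mem_compl, LPE, mem_filter, mem_filter, LPval_add hn]; simp; tauto
    have s2 : ∀ y : F, ∏ j ∈ (LPE n)ᶜ, LPFr q j (LPFr q u y) = ∏ j ∈ LPE n, LPFr q j y := by
      intro y
      apply LPprod_shift hF
      intro j; rw [mem_compl, LPE, mem_filter, mem_filter, LPval_add hn]; simp
      rw [← Nat.not_even_iff_odd]; tauto
    have a1 : ∏ j ∈ LPE n, LPFr q j (LPFr q u θ) = ∏ j ∈ LPE n, LPFr q j (d * LPFr q u d * LPFr q u δ) := by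
      rw [k1']
    have a2 : ∏ j ∈ (LPE n)ᶜ, LPFr q j (LPFr q u θ) = ∏ j ∈ (LPE n)ᶜ, LPFr q j (d * LPFr q u d * LPFr q u δ) := by
      rw [k1']
    simp only [LPFr_mul, Finset.prod_mul_distrib, s1, s2] at a1 a2
    rw [← Finset.prod_mul_prod_compl (LPE n)] at k2
    rw [← LPnorm2 hq2 hn, ← LPnorm2 hq2 hn]
    have hB : LPFr q u (∏ j ∈ LPE n, LPFr q j δ)⁻¹ = (∏ j ∈ (LPE n)ᶜ, LPFr q j δ)⁻¹ := by
      have h1 : LPFr q u (1 : F) = 1 := by simp [LPFr]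
      rw [← s1, ← one_div, LPFr_div, LPFr_prod, h1, one_div]
      congr 1
      · refine Finset.prod_congr rfl fun j _ => ?_
        rw [LPFr_comp hF, LPFr_comp hF, add_comm]
    rw [hB]
    have hB0 : ∏ j ∈ (LPE n)ᶜ, LPFr q j δ ≠ 0 :=
      Finset.prod_ne_zero_iff.2 fun j _ => LPFr_ne_zero j hδ0
    generalize ∏ j ∈ LPE n, LPFr q j θ = A at *
    generalize ∏ j ∈ (LPE n)ᶜ, LPFr q j θ = A' at *
    generalize ∏ j ∈ LPE n, LPFr q j δ = B at *
    generalize ∏ j ∈ (LPE n)ᶜ, LPFr q j δ = B' at *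
    generalize ∏ j ∈ LPE n, LPFr q j d = D at *
    generalize ∏ j ∈ (LPE n)ᶜ, LPFr q j d = D' at *
    have : (1 - D * D') * (1 - D * D' * B * B') = 0 := by
      rw [a1, a2] at k2; linear_combination -k2
    rcases mul_eq_zero.1 this with h | h
    · left; rw [a2]; linear_combination (-B) * h
    · right; rw [a2, ← one_div, eq_div_iff hB0]; linear_combination -h
  · left
    refine ⟨hn, ?_⟩
    rw [LPsumset_odd hn hq2 u huu, LPsumset_odd hn hq2 u huu, LPnorm hq2] at k2
    have s1 : ∀ y : F, (LPFr q u y) ^ ((q ^ n - 1) / (q - 1)) = y ^ ((q ^ n - 1) / (q - 1)) := by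
      intro y
      rw [← LPnorm (n := n) hq2, ← LPnorm (n := n) hq2]
      apply LPprod_shift hF
      simp
    have a1 : (LPFr q u θ) ^ ((q ^ n - 1) / (q - 1)) =
      (d * LPFr q u d * LPFr q u δ) ^ ((q ^ n - 1) / (q - 1)) := by rw [k1']
    simp only [mul_pow, s1] at a1
    have hB0 : δ ^ ((q ^ n - 1) / (q - 1)) ≠ 0 := pow_ne_zero _ hδ0
    generalize θ ^ ((q ^ n - 1) / (q - 1)) = A at *
    generalize δ ^ ((q ^ n - 1) / (q - 1)) = B at *
    generalize d ^ ((q ^ n - 1) / (q - 1)) = D at *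
    have : (1 - D) * (1 - D * B) = 0 := by
      rw [a1] at k2; linear_combination -k2
    rcases mul_eq_zero.1 this with h | h
    · left; rw [a1]; linear_combination (-B - D * B) * h
    · right; rw [a1, ← one_div, eq_div_iff hB0]; linear_combination (-1 - D * B) * h

theorem LProot (M : ℕ) (hM : Fintype.card F - 1 = M) (k e : ℕ) (he : Nat.gcd k M = e)
    (w : F) (hw0 : w ≠ 0) (hw : w ^ (M / e) = 1) : ∃ c : F, c ≠ 0 ∧ c ^ k = w := by
  classical
  have hM0 : 0 < M := by have := Fintype.one_lt_card (α := F); omega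
  have heM : e ∣ M := he ▸ Nat.gcd_dvd_right k M
  obtain ⟨m, rfl⟩ := heM
  have he0 : 0 < e := Nat.pos_of_mul_pos_right hM0
  have hm0 : 0 < m := Nat.pos_of_mul_pos_left hM0
  rw [Nat.mul_div_cancel_left _ he0] at hw
  obtain ⟨g, hg⟩ := IsCyclic.exists_generator (α := Fˣ)
  have hord : orderOf g = e * m := by
    rw [orderOf_eq_card_of_forall_mem_zpowers hg, Nat.card_eq_fintype_card, Fintype.card_units, hM]
  obtain ⟨a, ha⟩ := hg (Units.mk0 w hw0)
  simp only at ha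
  have h1 : g ^ (a * m) = 1 := by
    rw [zpow_mul, ha, zpow_natCast]
    ext; simpa using hw
  rw [← orderOf_dvd_iff_zpow_eq_one, hord] at h1
  push_cast at h1
  have h2 : (e : ℤ) ∣ a := Int.dvd_of_mul_dvd_mul_right (by exact_mod_cast hm0.ne') h1
  obtain ⟨b, rfl⟩ := h2
  have bez := Nat.gcd_eq_gcd_ab k (e * m)
  rw [he] at bez
  refine ⟨((g ^ (Nat.gcdA k (e * m) * b) : Fˣ) : F), Units.ne_zero _, ?_⟩
  have h3 : (g ^ (Nat.gcdA k (e * m) * b)) ^ k = Units.mk0 w hw0 := by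
    rw [← ha, ← zpow_natCast, ← zpow_mul, ← div_eq_one, div_eq_mul_inv, ← zpow_sub, ← orderOf_dvd_iff_zpow_eq_one, hord]
    refine ⟨-(Nat.gcdB k (e * m) * b), ?_⟩
    linear_combination (-b) * bez
  rw [← Units.val_pow_eq_pow_val, h3]; rfl

/-- The trace form pairing. -/
theorem LPadjoint {p r : ℕ} [Fact p.Prime] [CharP F p] (hq : q = p ^ r)
    (hF : Fintype.card F = q ^ n) (hq3 : 3 ≤ q) (u : ZMod n) (a b m : F)
    (h : ∃ x : F, x ≠ 0 ∧ a * LPFr q u x + b * LPFr q (-u) x = m * x) :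
    ∃ y : F, y ≠ 0 ∧ LPFr q u b * LPFr q u y + LPFr q (-u) a * LPFr q (-u) y = m * y := by
  classical
  obtain ⟨x, hx0, hx⟩ := h
  by_contra hcon
  push Not at hcon
  let T : F →+ F := AddMonoidHom.mk'
    (fun y => LPFr q u b * LPFr q u y + LPFr q (-u) a * LPFr q (-u) y - m * y)
    (fun y z => by rw [LPFr_add hq, LPFr_add hq]; ring)
  have hT : Function.Injective T := by
    rw [injective_iff_map_eq_zero]
    intro y hy
    by_contra hy0
    exact hcon y hy0 (sub_eq_zero.1 hy)
  have hTs : Function.Surjective T := Finite.surjective_of_injective hT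
  let Tr : F → F := fun z => ∑ j : ZMod n, LPFr q j z
  have hTradd : ∀ y z, Tr (y + z) = Tr y + Tr z := by
    intro y z; simp only [Tr, LPFr_add hq, Finset.sum_add_distrib]
  have hTrF : ∀ (i : ZMod n) z, Tr (LPFr q i z) = Tr z := by
    intro i z
    simp only [Tr, LPFr_comp hF]
    exact Equiv.sum_comp (Equiv.addRight i) (fun j => LPFr q j z)
  have hTr0 : ∀ z, Tr z = 0 := by
    intro z
    obtain ⟨y, hy⟩ := hTs (z / x)
    have hz : z = x * T y := by rw [hy]; field_simp
    have e1 : z + m * x * y = x * (LPFr q u b * LPFr q u y) + x * (LPFr q (-u) a * LPFr q (-u) y) := by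
      rw [hz]; simp only [T, AddMonoidHom.mk'_apply]; ring
    have e2 : Tr (z + m * x * y) = Tr (m * x * y) := by
      rw [e1, hTradd, ← hTrF (-u) (x * (LPFr q u b * LPFr q u y)),
        ← hTrF u (x * (LPFr q (-u) a * LPFr q (-u) y)), ← hTradd]
      congr 1
      simp only [LPFr_mul, LPFr_comp hF, add_neg_cancel, neg_add_cancel, LPFr_zero]
      linear_combination y * hx
    rw [hTradd] at e2
    simpa using e2
  have : ∑ x : Fˣ, Tr x / x = -1 := by
    simp only [Tr, Finset.sum_div]
    rw [Finset.sum_comm]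
    have hs : ∀ j : ZMod n, ∑ x : Fˣ, LPFr q j (x : F) / (x : F) = if j = 0 then -1 else 0 := by
      intro j
      have := LPsum2 (F := F) hF hq3 j 0 0 0
      have e : ∀ x : Fˣ, LPFr q j (x : F) * LPFr q (0 : ZMod n) (x : F) / (LPFr q (0 : ZMod n) (x : F) * LPFr q (0 : ZMod n) (x : F)) = LPFr q j (x : F) / (x : F) := by
        intro x
        rw [LPFr_zero, mul_div_mul_right _ _ x.ne_zero]
      simp_rw [e] at this
      rw [this]
      congr 1
      rw [eq_iff_iff]
      constructor
      · intro h
        by_contra hj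
        have := congrFun h j
        simp [hj] at this
      · rintro rfl; rfl
    simp_rw [hs]
    simp
  simp [hTr0] at this

theorem LPback_adj {p r : ℕ} [Fact p.Prime] [CharP F p] (hq : q = p ^ r)
    (hF : Fintype.card F = q ^ n) (hq3 : 3 ≤ q) (u : ZMod n) (θ : F) (hθ : θ ≠ 0) :
    {y : F | ∃ x : F, x ≠ 0 ∧ y = (LPFr q u x + θ * LPFr q (-u) x) / x} =
      {y : F | ∃ x : F, x ≠ 0 ∧
        y = LPFr q u θ * (LPFr q u x + LPFr q u θ⁻¹ * LPFr q (-u) x) / x} := by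
  have hθ' : LPFr q u θ * LPFr q u θ⁻¹ = 1 := by
    rw [← LPFr_mul, mul_inv_cancel₀ hθ]; simp [LPFr]
  have h1 : ∀ j : ZMod n, LPFr q j (1 : F) = 1 := by intro j; simp [LPFr]
  ext m
  simp only [Set.mem_ofPred_eq]
  constructor
  · rintro ⟨x, hx, e⟩
    rw [eq_div_iff hx] at e
    obtain ⟨y, hy, e'⟩ := LPadjoint hq hF hq3 u 1 θ m ⟨x, hx, by rw [one_mul, e]⟩
    refine ⟨y, hy, ?_⟩
    rw [eq_div_iff hy, ← e', h1]
    linear_combination (-LPFr q (-u) y) * hθ'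
  · rintro ⟨x, hx, e⟩
    rw [eq_div_iff hx] at e
    obtain ⟨y, hy, e'⟩ := LPadjoint hq hF hq3 u (LPFr q u θ) 1 m ⟨x, hx, by
      rw [e]; linear_combination (-LPFr q (-u) x) * hθ'⟩
    refine ⟨y, hy, ?_⟩
    rw [eq_div_iff hy, ← e', h1, LPFr_comp hF, neg_add_cancel, LPFr_zero, one_mul]

theorem LPback (hF : Fintype.card F = q ^ n) (hq3 : 3 ≤ q) (s e : ℕ) (hs : 2 * s < n)
    (he : Nat.gcd (n - 2 * s) n = e) (θ δ : F) (hθ : θ ≠ 0) (hδ : δ ≠ 0)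
    (hN : θ ^ ((q ^ n - 1) / (q ^ e - 1)) = δ ^ ((q ^ n - 1) / (q ^ e - 1))) :
    ∃ d : F, {y : F | ∃ x : F, x ≠ 0 ∧ y = (LPFr q (s : ZMod n) x + θ * LPFr q (-(s : ZMod n)) x) / x} =
      {y : F | ∃ x : F, x ≠ 0 ∧
        y = d * (LPFr q (s : ZMod n) x + δ * LPFr q (-(s : ZMod n)) x) / x} := by
  obtain ⟨v, hv0, hv⟩ := LProot (F := F) (q ^ n - 1) (by rw [hF]) (q ^ (n - 2 * s) - 1) (q ^ e - 1)
    (by rw [Nat.pow_sub_one_gcd_pow_sub_one, he]) (δ / θ) (div_ne_zero hδ hθ)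
    (by rw [div_pow, ← hN, div_self (pow_ne_zero _ hθ)])
  have hv' : LPFr q (-(s : ZMod n) + -(s : ZMod n)) v * θ = δ * v := by
    have h1 : -(s : ZMod n) + -(s : ZMod n) = ((n - 2 * s : ℕ) : ZMod n) := by
      rw [Nat.cast_sub hs.le]; push_cast; simp; ring
    rw [h1, ← LPFr_pow hF]
    have h2 : q ^ (n - 2 * s) = (q ^ (n - 2 * s) - 1) + 1 := by
      have : 0 < q ^ (n - 2 * s) := by positivity
      omega
    rw [h2, pow_succ, hv]; field_simp
  generalize (s : ZMod n) = u at *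
  set c := LPFr q (-u) v with hc
  have hc0 : c ≠ 0 := LPFr_ne_zero _ hv0
  have h1 : LPFr q u c = v := by rw [hc, LPFr_comp hF, add_neg_cancel, LPFr_zero]
  have h2 : LPFr q (-u) c = δ * v / θ := by rw [hc, LPFr_comp hF, ← hv']; field_simp
  refine ⟨v / c, ?_⟩
  have key : ∀ x : F, x ≠ 0 → (LPFr q u (c * x) + θ * LPFr q (-u) (c * x)) / (c * x) =
      v / c * (LPFr q u x + δ * LPFr q (-u) x) / x := by
    intro x hx
    rw [LPFr_mul, LPFr_mul, h1, h2]
    field_simp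
  ext y
  simp only [Set.mem_ofPred_eq]
  constructor
  · rintro ⟨x, hx, rfl⟩
    refine ⟨x / c, div_ne_zero hx hc0, ?_⟩
    rw [← key _ (div_ne_zero hx hc0), mul_div_cancel₀ _ hc0]
  · rintro ⟨x, hx, rfl⟩
    exact ⟨c * x, mul_ne_zero hc0 hx, (key x hx).symm⟩

theorem LPback' {p r : ℕ} [Fact p.Prime] [CharP F p] (hq : q = p ^ r)
    (hF : Fintype.card F = q ^ n) (hq3 : 3 ≤ q) (s e : ℕ) (hs : 2 * s < n)
    (he : Nat.gcd (n - 2 * s) n = e) (hee : e ∣ 2 * s) (hen : e ∣ n)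
    (θ δ : F) (hθ : θ ≠ 0) (hδ : δ ≠ 0)
    (hN : θ ^ ((q ^ n - 1) / (q ^ e - 1)) = ((δ ^ ((q ^ n - 1) / (q ^ e - 1)))⁻¹) ^ q ^ s) :
    ∃ d : F, {y : F | ∃ x : F, x ≠ 0 ∧ y = (LPFr q (s : ZMod n) x + θ * LPFr q (-(s : ZMod n)) x) / x} =
      {y : F | ∃ x : F, x ≠ 0 ∧
        y = d * (LPFr q (s : ZMod n) x + δ * LPFr q (-(s : ZMod n)) x) / x} := by
  have hfix : (δ ^ ((q ^ n - 1) / (q ^ e - 1))) ^ q ^ e = δ ^ ((q ^ n - 1) / (q ^ e - 1)) := by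
    have h2 : q ^ e = (q ^ e - 1) + 1 := by
      have : 0 < q ^ e := by positivity
      omega
    have hd : q ^ e - 1 ∣ q ^ n - 1 := Nat.pow_sub_one_dvd_pow_sub_one q hen
    nth_rewrite 2 [h2]
    rw [pow_succ, ← pow_mul, Nat.div_mul_cancel hd, ← hF, FiniteField.pow_card_sub_one_eq_one _ hδ,
      one_mul]
  have hfix2 : (δ ^ ((q ^ n - 1) / (q ^ e - 1))) ^ q ^ (2 * s) = δ ^ ((q ^ n - 1) / (q ^ e - 1)) := by
    obtain ⟨k, hk⟩ := hee
    rw [hk, pow_mul]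
    generalize δ ^ ((q ^ n - 1) / (q ^ e - 1)) = B at *
    clear hk
    induction k with
    | zero => simp
    | succ k ih => rw [pow_succ, pow_mul, ih, hfix]
  obtain ⟨d, hd⟩ := LPback hF hq3 s e hs he (LPFr q (s : ZMod n) θ⁻¹) δ
    (LPFr_ne_zero _ (inv_ne_zero hθ)) hδ (by
      rw [← LPFr_pow hF, ← pow_mul, mul_comm, pow_mul, inv_pow, hN, inv_pow, inv_pow, inv_pow, inv_inv, ← pow_mul,
        ← pow_add, ← two_mul, hfix2])
  refine ⟨LPFr q (s : ZMod n) θ * d, ?_⟩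
  rw [LPback_adj hq hF hq3 _ θ hθ]
  ext y
  have hθ' := LPFr_ne_zero (q := q) (s : ZMod n) hθ
  have := Set.ext_iff.1 hd (y / LPFr q (s : ZMod n) θ)
  simp only [Set.mem_ofPred_eq] at this ⊢
  have e1 : ∀ x z : F, y = LPFr q (s : ZMod n) θ * z / x ↔ y / LPFr q (s : ZMod n) θ = z / x := by
    intro x z; rw [div_eq_iff hθ']; ring_nf
  simp only [mul_assoc, e1]
  rw [this]
end


/-- **Necessary and sufficient condition for `L_f = L_{d·g}`.**
For `f(x) = x^{q^s} + θ x^{q^{n-s}}` and `g(x) = x^{q^s} + δ x^{q^{n-s}}`, there exists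
`d ∈ F_{q^n}` with `{f(x)/x} = {d·g(x)/x}` if and only if
`N_{q^n/q}(θ) ∈ {N_{q^n/q}(δ), N_{q^n/q}(δ)⁻¹}` when `n` is odd, and
`N_{q^n/q²}(θ) ∈ {N_{q^n/q²}(δ), (N_{q^n/q²}(δ)⁻¹)^{q^s}}` when `n` is even. -/
theorem LP_equal_linear_sets_iff (p r q n s : ℕ) (hp : p.Prime) (hr : 0 < r)
    (hq : q = p ^ r) (hs : 0 < s) (hsn : Nat.Coprime s n) (hs2 : 2 * s < n)
    (F : Type*) [Field F] [Fintype F] (hF : Fintype.card F = q ^ n)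
    (θ δ : F) (hθ0 : θ ≠ 0) (hδ0 : δ ≠ 0)
    (hθ1 : θ ^ ((q ^ n - 1) / (q - 1)) ≠ 1) (hδ1 : δ ^ ((q ^ n - 1) / (q - 1)) ≠ 1) :
    (∃ d : F,
      {y : F | ∃ x : F, x ≠ 0 ∧ y = (x ^ q ^ s + θ * x ^ q ^ (n - s)) / x} =
      {y : F | ∃ x : F, x ≠ 0 ∧ y = d * (x ^ q ^ s + δ * x ^ q ^ (n - s)) / x}) ↔
    ((Odd n ∧
        (θ ^ ((q ^ n - 1) / (q - 1)) = δ ^ ((q ^ n - 1) / (q - 1)) ∨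
         θ ^ ((q ^ n - 1) / (q - 1)) = (δ ^ ((q ^ n - 1) / (q - 1)))⁻¹)) ∨
     (Even n ∧
        (θ ^ ((q ^ n - 1) / (q ^ 2 - 1)) = δ ^ ((q ^ n - 1) / (q ^ 2 - 1)) ∨
         θ ^ ((q ^ n - 1) / (q ^ 2 - 1)) = ((δ ^ ((q ^ n - 1) / (q ^ 2 - 1)))⁻¹) ^ q ^ s))) := by
  have : NeZero n := ⟨by omega⟩
  have : Fact p.Prime := ⟨hp⟩
  have hcard : Fintype.card F = p ^ (r * n) := by rw [hF, hq, pow_mul]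
  have : CharP F p := by
    obtain ⟨p', hp'⟩ := CharP.exists F
    obtain ⟨k, hk, hk'⟩ := FiniteField.card F p'
    have : p' ∣ p ^ (r * n) := by
      rw [← hcard, hk']; exact dvd_pow_self _ k.pos.ne'
    have := (Nat.prime_dvd_prime_iff_eq hk hp).1 (hk.dvd_of_dvd_pow this)
    rwa [← this]
  have hq3 : 3 ≤ q := by
    have h2 : 2 ≤ q := by
      rw [hq]; exact hp.two_le.trans (Nat.le_self_pow hr.ne' p)
    by_contra hlt
    have : q = 2 := by omega
    apply hθ1
    have e : (q ^ n - 1) / (q - 1) = q ^ n - 1 := by rw [this]; simp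
    rw [e, ← hF, FiniteField.pow_card_sub_one_eq_one _ hθ0]
  have hsc : ((n - s : ℕ) : ZMod n) = -(s : ZMod n) := by
    rw [Nat.cast_sub (by omega)]; simp
  simp only [LPFr_pow (q := q) (n := n) hF s, LPFr_pow (q := q) (n := n) hF (n - s), hsc]
  constructor
  · rintro ⟨d, hd⟩
    refine LPforward hq hF hq3 (s : ZMod n) ?_ ?_ ?_ θ δ hδ0 d hd
    · intro h
      rw [ZMod.natCast_eq_zero_iff] at h
      have := Nat.le_of_dvd hs h
      omega
    · intro h
      have h' : ((s + s : ℕ) : ZMod n) = 0 := by push_cast; exact h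
      rw [ZMod.natCast_eq_zero_iff] at h'
      have := Nat.le_of_dvd (by omega) h'
      omega
    · exact (ZMod.isUnit_iff_coprime s n).2 hsn
  · have hgcd : Nat.gcd (n - 2 * s) n = Nat.gcd 2 n := by
      rw [Nat.gcd_comm, Nat.gcd_self_sub_right hs2.le, Nat.gcd_comm, Nat.Coprime.gcd_mul_right_cancel 2 hsn]
    rintro (⟨hn, h⟩ | ⟨hn, h⟩)
    · have he : Nat.gcd (n - 2 * s) n = 1 := by rw [hgcd]; simpa using hn
      rcases h with h | h
      · exact LPback hF hq3 s 1 hs2 he θ δ hθ0 hδ0 (by simpa using h)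
      · refine LPback' hq hF hq3 s 1 hs2 he (one_dvd _) (one_dvd _) θ δ hθ0 hδ0 ?_
        rw [pow_one, h, LPFr_pow (q := q) (n := n) hF s, ← inv_pow, ← LPnorm (n := n) (by omega),
          LPFr_prod]
        rw [← LPprod_shift hF univ univ (s : ZMod n) (by simp)]
        refine Finset.prod_congr rfl fun j _ => ?_
        rw [LPFr_comp hF, LPFr_comp hF, add_comm]
    · have he : Nat.gcd (n - 2 * s) n = 2 := by rw [hgcd]; exact Nat.gcd_eq_left hn.two_dvd
      rcases h with h | h
      · exact LPback hF hq3 s 2 hs2 he θ δ hθ0 hδ0 h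
      · refine LPback' hq hF hq3 s 2 hs2 he (dvd_mul_right _ _) hn.two_dvd θ δ hθ0 hδ0 ?_
        rw [LPFr_pow (q := q) (n := n) hF s]; exact h
end

section
/- Let n > 4 and let s, t be integers with gcd(s,n) = gcd(t,n) = 1 and 1 ≤ s, t < n/2. Let θ, δ ∈ F_{q^n} satisfy N_{q^n/q}(θ) ∉ {0,1} and N_{q^n/q}(δ) ∉ {0,1}, and set f(x) = x^{q^s} + θ·x^{q^{n−s}} and g(x) = x^{q^t} + δ·x^{q^{n−t}}. If the map x ↦ f(x) is bijective on F_{q^n}, then there is no nonzero constant c ∈ F_{q^n} such that {c·x/f(x) : x ∈ F_{q^n}^*} = {g(x)/x : x ∈ F_{q^n}^*}. -/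
theorem LP_pow_sum_aux {q a b c d : ℕ} (hq : 2 ≤ q) (hab : a ≤ b) (hcd : c < d)
    (h : q ^ a + q ^ b = q ^ c + q ^ d) : a = c ∧ b = d := by
  have h1 : q ^ a ≤ q ^ b := Nat.pow_le_pow_right (by omega) hab
  have h2 : q ^ c < q ^ d := Nat.pow_lt_pow_right (by omega) hcd
  have h3 : 0 < q ^ a := by positivity
  have h4 : 0 < q ^ c := by positivity
  have h5 : 2 * q ^ b ≤ q ^ (b + 1) := by rw [pow_succ]; nlinarith
  have h6 : 2 * q ^ d ≤ q ^ (d + 1) := by rw [pow_succ]; nlinarith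
  have hbd : b < d + 1 := (Nat.pow_lt_pow_iff_right (a := q) (by omega)).1 (by omega)
  have hdb : d < b + 1 := (Nat.pow_lt_pow_iff_right (a := q) (by omega)).1 (by omega)
  have e : b = d := by omega
  subst e
  exact ⟨Nat.pow_right_injective hq (by simpa using h), rfl⟩

theorem LP_pow_sum {q a b c d : ℕ} (hq : 2 ≤ q) (hcd : c ≠ d)
    (h : q ^ a + q ^ b = q ^ c + q ^ d) : (a = c ∧ b = d) ∨ (a = d ∧ b = c) := by
  rcases le_total a b with h1 | h1 <;> rcases lt_or_gt_of_ne hcd with h2 | h2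
  · have := LP_pow_sum_aux hq h1 h2 h; omega
  · have := LP_pow_sum_aux hq h1 h2 (by omega); omega
  · have := LP_pow_sum_aux hq h1 h2 (by omega); omega
  · have := LP_pow_sum_aux hq h1 h2 (by omega); omega

theorem LP_pow_bound {q n a : ℕ} (hq : 2 ≤ q) (ha : a < n) : 2 * q ^ a ≤ q ^ n := by
  calc 2 * q ^ a ≤ q ^ (a + 1) := by rw [pow_succ]; nlinarith [Nat.zero_le (q ^ a)]
    _ ≤ q ^ n := Nat.pow_le_pow_right (by omega) ha

theorem LP_dvd2 {q n a b c d : ℕ} (hq : 2 ≤ q) (hn : 3 ≤ n) (ha : a < n) (hb : b < n)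
    (hc : c < n) (hd : d < n) (hcd : c ≠ d) :
    ((q : ℤ) ^ n - 1 ∣ (q : ℤ) ^ a + q ^ b - q ^ c - q ^ d) ↔
      (a = c ∧ b = d) ∨ (a = d ∧ b = c) := by
  constructor
  · intro h
    have ha' := LP_pow_bound hq ha
    have hb' := LP_pow_bound hq hb
    have hc' := LP_pow_bound hq hc
    have hd' := LP_pow_bound hq hd
    have pa : 0 < q ^ a := by positivity
    have pb : 0 < q ^ b := by positivity
    have pc : 0 < q ^ c := by positivity
    have pd : 0 < q ^ d := by positivity
    have hB : q ^ c ≠ q ^ d := fun h => hcd (Nat.pow_right_injective hq h)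
    apply LP_pow_sum hq hcd
    zify at *
    have := Int.eq_zero_of_abs_lt_dvd h (by rw [abs_lt]; constructor <;> omega)
    linarith
  · rintro (⟨rfl, rfl⟩ | ⟨rfl, rfl⟩) <;> ring_nf <;> simp

theorem LP_dvd1 {q n a c : ℕ} (hq : 2 ≤ q) (hn : 3 ≤ n) (ha : a < n) (hc : c < n) :
    ((q : ℤ) ^ n - 1 ∣ (q : ℤ) ^ a - q ^ c) ↔ a = c := by
  constructor
  · intro h
    have ha' := LP_pow_bound hq ha
    have hc' := LP_pow_bound hq hc
    have pa : 0 < q ^ a := by positivity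
    have pc : 0 < q ^ c := by positivity
    apply Nat.pow_right_injective hq
    show q ^ a = q ^ c
    zify at *
    have := Int.eq_zero_of_abs_lt_dvd h (by rw [abs_lt]; constructor <;> omega)
    linarith
  · rintro rfl; simp

theorem LP_sum_zpow (F : Type*) [Field F] [Fintype F] [DecidableEq F] (z : ℤ) :
    ∑ x : Fˣ, (x : F) ^ z = if ((Fintype.card F : ℤ) - 1 ∣ z) then -1 else 0 := by
  have hc : 1 < Fintype.card F := Fintype.one_lt_card
  set N : ℤ := (Fintype.card F : ℤ) - 1 with hN
  have hNpos : 0 < N := by omega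
  have hx : ∀ x : Fˣ, (x : F) ^ z = (x ^ (z % N).toNat : Fˣ) := by
    intro x
    have h1 : x ^ N = 1 := by
      have : N = ((Fintype.card F - 1 : ℕ) : ℤ) := by omega
      rw [this, zpow_natCast]
      have := FiniteField.pow_card_sub_one_eq_one (x : F) x.ne_zero
      ext; simpa using this
    have h2 : x ^ z = x ^ (z % N).toNat := by
      conv_lhs => rw [← Int.emod_add_mul_ediv z N, zpow_add, zpow_mul, h1, one_zpow, mul_one]
      rw [← zpow_natCast, Int.toNat_of_nonneg (Int.emod_nonneg _ hNpos.ne')]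
    rw [← h2]; simp
  simp_rw [hx]
  have := FiniteField.sum_pow_units F (z % N).toNat
  simp only [Units.val_pow_eq_pow_val] at this ⊢
  rw [this]
  have hiff : (Fintype.card F - 1 ∣ (z % N).toNat) ↔ N ∣ z := by
    rw [← Int.natCast_dvd_natCast, Int.toNat_of_nonneg (Int.emod_nonneg _ hNpos.ne')]
    have : ((Fintype.card F - 1 : ℕ) : ℤ) = N := by omega
    rw [this]
    exact (EuclideanDomain.dvd_mod_iff (dvd_refl N))
  simp [hiff]

/-- The fibre sum depends only on the set of values. -/
theorem LP_fibre (F : Type*) [Field F] [Fintype F] [DecidableEq F] (p m : ℕ) (hp : p.Prime)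
    (hF : Fintype.card F = p ^ m) [CharP F p]
    (u : F →+ F) (P : F → F) :
    ∑ x : Fˣ, P (u x / x) = - ∑ y ∈ Finset.univ.filter (fun y => ∃ x : F, x ≠ 0 ∧ y = u x / x), P y := by
  rw [← Finset.sum_fiberwise (s := Finset.univ) (g := fun x : Fˣ => u x / (x : F)),
    ← Finset.sum_neg_distrib, Finset.sum_filter]
  apply Finset.sum_congr rfl
  intro y _
  have h1 : ∑ x ∈ Finset.univ.filter (fun x : Fˣ => u x / (x : F) = y), P (u x / x) =
      ((Finset.univ.filter (fun x : Fˣ => u x / (x : F) = y)).card : F) * P y := by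
    rw [Finset.sum_congr rfl (g := fun _ => P y)]
    · simp
    · intro x hx; simp at hx; rw [hx]
  rw [h1]
  split_ifs with h
  · let G : AddSubgroup F := (u - AddMonoidHom.mulLeft y).ker
    have hG : ∀ x, x ∈ G ↔ u x = y * x := by
      intro x; simp [G, AddMonoidHom.mem_ker, sub_eq_zero]
    have hdiv : Nat.card G ∣ p ^ m := by
      rw [← hF, ← Nat.card_eq_fintype_card]; exact AddSubgroup.card_addSubgroup_dvd_card G
    have hcard : Nat.card G = (Finset.univ.filter (fun x : Fˣ => u x / (x : F) = y)).card + 1 := by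
      have h2 : (Finset.univ.filter (fun x : F => x ∈ G)) =
          insert 0 ((Finset.univ.filter (fun x : Fˣ => u x / (x : F) = y)).map
            ⟨Units.val, Units.val_injective⟩) := by
        ext x
        simp only [Finset.mem_filter, Finset.mem_univ, true_and, hG, Finset.mem_insert,
          Finset.mem_map, Function.Embedding.coeFn_mk]
        constructor
        · intro hx
          by_cases h0 : x = 0
          · exact Or.inl h0
          · right
            exact ⟨Units.mk0 x h0, by simp [hx, h0], rfl⟩
        · rintro (rfl | ⟨x, hx, rfl⟩)
          · simp
          · rw [← hx]; field_simp
      have h3 : Nat.card G = (Finset.univ.filter (fun x : F => x ∈ G)).card := by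
        rw [Nat.card_eq_fintype_card, Fintype.card_subtype]
      rw [h3, h2, Finset.card_insert_of_notMem, Finset.card_map]
      simp
    obtain ⟨k, hk, hk2⟩ := (Nat.dvd_prime_pow hp).1 hdiv
    have hk0 : k ≠ 0 := by
      rintro rfl
      obtain ⟨x, hx0, hx⟩ := h
      have : 0 < (Finset.univ.filter (fun x : Fˣ => u x / (x : F) = y)).card :=
        Finset.card_pos.2 ⟨Units.mk0 x hx0, by simp [hx]⟩
      rw [pow_zero] at hk2
      omega
    have h4 : ((Nat.card G : ℕ) : F) = 0 := by
      rw [CharP.cast_eq_zero_iff F p, hk2]; exact dvd_pow_self p hk0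
    rw [hcard] at h4
    push_cast at h4
    rw [eq_neg_of_add_eq_zero_left h4]; ring
  · rw [Finset.filter_eq_empty_iff.2]
    · simp
    · intro x _ hx
      exact h ⟨x, x.ne_zero, hx.symm⟩

/-- The `q^i`-power map, with exponent index modulo `n`. -/
def LPphi (q n : ℕ) {F : Type*} [Field F] (i : ZMod n) (x : F) : F := x ^ q ^ i.val

section phi
variable {q n : ℕ} {F : Type*} [Field F] [Fintype F]

theorem LPphi_cast [NeZero n] (hF : Fintype.card F = q ^ n) (m : ℕ) (x : F) :
    LPphi q n (m : ZMod n) x = x ^ q ^ m := by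
  unfold LPphi
  rw [ZMod.val_natCast]
  conv_rhs => rw [← Nat.mod_add_div m n, pow_add, pow_mul, pow_mul q, ← hF,
    FiniteField.pow_card_pow]

theorem LPphi_comp [NeZero n] (hF : Fintype.card F = q ^ n) (i j : ZMod n) (x : F) :
    LPphi q n i (LPphi q n j x) = LPphi q n (i + j) x := by
  have : i + j = ((i.val + j.val : ℕ) : ZMod n) := by simp
  rw [this, LPphi_cast hF]
  unfold LPphi
  rw [← pow_mul, ← pow_add, add_comm]

theorem LPphi_zero [NeZero n] (x : F) : LPphi q n 0 x = x := by
  simp [LPphi]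

theorem LPphi_mul (i : ZMod n) (x y : F) :
    LPphi q n i (x * y) = LPphi q n i x * LPphi q n i y := mul_pow _ _ _

theorem LPphi_inv (i : ZMod n) (x : F) :
    LPphi q n i (x⁻¹) = (LPphi q n i x)⁻¹ := inv_pow _ _

theorem LPphi_eq_zero (hq : 2 ≤ q) (i : ZMod n) (x : F) :
    LPphi q n i x = 0 ↔ x = 0 := by
  unfold LPphi
  exact pow_eq_zero_iff (by positivity)

theorem LPphi_add {p r : ℕ} [ExpChar F p] (hq : q = p ^ r) (i : ZMod n) (x y : F) :
    LPphi q n i (x + y) = LPphi q n i x + LPphi q n i y := by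
  unfold LPphi
  rw [hq, ← pow_mul, add_pow_expChar_pow]

/-- Additive version. -/
def LPphiHom {p r : ℕ} [ExpChar F p] (hq : q = p ^ r) (hq2 : 2 ≤ q) (i : ZMod n) : F →+ F where
  toFun := LPphi q n i
  map_zero' := (LPphi_eq_zero hq2 i 0).2 rfl
  map_add' := LPphi_add hq i

theorem LPphi_sum {p r : ℕ} [ExpChar F p] (hq : q = p ^ r) (hq2 : 2 ≤ q) (i : ZMod n)
    {ι : Type*} (s : Finset ι) (a : ι → F) :
    LPphi q n i (∑ j ∈ s, a j) = ∑ j ∈ s, LPphi q n i (a j) :=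
  map_sum (LPphiHom (n := n) (F := F) hq hq2 i) a s

/-- The linearized polynomial with coefficients `a`. -/
def LPlin {p r : ℕ} [NeZero n] [ExpChar F p] (hq : q = p ^ r) (hq2 : 2 ≤ q) (a : ZMod n → F) :
    F →+ F :=
  ∑ i, (AddMonoidHom.mulLeft (a i)).comp (LPphiHom (n := n) hq hq2 i)

theorem LPlin_apply {p r : ℕ} [NeZero n] [ExpChar F p] (hq : q = p ^ r) (hq2 : 2 ≤ q)
    (a : ZMod n → F) (x : F) : LPlin hq hq2 a x = ∑ i, a i * LPphi q n i x := by
  simp [LPlin, AddMonoidHom.finsetSum_apply]; rfl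

variable [DecidableEq F]

theorem LP_sum1 [NeZero n] [DecidableEq (ZMod n)] (hF : Fintype.card F = q ^ n) (hq2 : 2 ≤ q) (hn : 3 ≤ n)
    (i j : ZMod n) :
    ∑ x : Fˣ, LPphi q n i (x : F) * (LPphi q n j (x : F))⁻¹ = if i = j then -1 else 0 := by
  classical
  have h := LP_sum_zpow F ((q : ℤ) ^ i.val - q ^ j.val)
  have hN : (Fintype.card F : ℤ) = (q : ℤ) ^ n := by rw [hF]; simp
  rw [hN] at h
  simp only [LP_dvd1 hq2 hn (ZMod.val_lt i) (ZMod.val_lt j), (ZMod.val_injective n).eq_iff] at h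
  rw [← h]
  refine Finset.sum_congr rfl fun x _ => ?_
  rw [zpow_sub₀ x.ne_zero]
  unfold LPphi
  rw [div_eq_mul_inv]
  norm_cast

theorem LP_sum2 [NeZero n] [DecidableEq (ZMod n)] (hF : Fintype.card F = q ^ n) (hq2 : 2 ≤ q) (hn : 3 ≤ n)
    (i j k : ZMod n) (hk : k ≠ 0) :
    ∑ x : Fˣ, LPphi q n i (x : F) * LPphi q n j (x : F) *
      ((x : F) * LPphi q n k (x : F))⁻¹ =
      if (i = 0 ∧ j = k) ∨ (i = k ∧ j = 0) then -1 else 0 := by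
  classical
  have h := LP_sum_zpow F ((q : ℤ) ^ i.val + q ^ j.val - q ^ (0 : ZMod n).val - q ^ k.val)
  have hN : (Fintype.card F : ℤ) = (q : ℤ) ^ n := by rw [hF]; simp
  rw [hN] at h
  simp only [LP_dvd2 hq2 hn (ZMod.val_lt i) (ZMod.val_lt j) (ZMod.val_lt 0) (ZMod.val_lt k)
    (fun h => hk (ZMod.val_injective n h).symm), (ZMod.val_injective n).eq_iff] at h
  rw [← h]
  refine Finset.sum_congr rfl fun x _ => ?_
  rw [zpow_sub₀ x.ne_zero, zpow_sub₀ x.ne_zero, zpow_add₀ x.ne_zero]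
  unfold LPphi
  rw [ZMod.val_zero, pow_zero, zpow_one, mul_inv, div_eq_mul_inv, div_eq_mul_inv, mul_assoc, mul_assoc,
    mul_assoc]
  norm_cast

theorem LP_moment1 {p r : ℕ} [NeZero n] [ExpChar F p] (hq : q = p ^ r) (hq2 : 2 ≤ q)
    (hF : Fintype.card F = q ^ n) (hn : 3 ≤ n) (a : ZMod n → F) (j : ZMod n) :
    ∑ x : Fˣ, LPlin hq hq2 a (x : F) * (LPphi q n j (x : F))⁻¹ = - a j := by
  classical
  simp_rw [LPlin_apply, Finset.sum_mul, mul_assoc]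
  rw [Finset.sum_comm]
  simp_rw [← Finset.mul_sum, LP_sum1 hF hq2 hn]
  simp

theorem LP_moment2 {p r : ℕ} [NeZero n] [ExpChar F p] (hq : q = p ^ r) (hq2 : 2 ≤ q)
    (hF : Fintype.card F = q ^ n) (hn : 3 ≤ n) (a : ZMod n → F) (k : ZMod n) (hk : k ≠ 0) :
    ∑ x : Fˣ, (LPlin hq hq2 a (x : F) / x) * LPphi q n k (LPlin hq hq2 a (x : F) / x) =
      - (a 0 * LPphi q n k (a 0) + a k * LPphi q n k (a (-k))) := by
  classical
  have h1 : ∀ x : Fˣ, (LPlin hq hq2 a (x : F) / x) * LPphi q n k (LPlin hq hq2 a (x : F) / x) =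
      ∑ i, ∑ j, (a i * LPphi q n k (a j)) * (LPphi q n i (x : F) * LPphi q n (k + j) (x : F) *
      ((x : F) * LPphi q n k (x : F))⁻¹) := by
    intro x
    rw [div_eq_mul_inv, LPphi_mul, LPphi_inv, LPlin_apply, LPphi_sum hq hq2]
    simp_rw [LPphi_mul, LPphi_comp hF]
    rw [mul_mul_mul_comm, ← mul_inv, Finset.sum_mul_sum, Finset.sum_mul]
    refine Finset.sum_congr rfl fun i _ => ?_
    rw [Finset.sum_mul]
    refine Finset.sum_congr rfl fun j _ => ?_
    ring
  simp_rw [h1]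
  rw [Finset.sum_comm]
  have h2 : ∀ i, ∑ x : Fˣ, ∑ j, (a i * LPphi q n k (a j)) * (LPphi q n i (x : F) * LPphi q n (k + j) (x : F) *
      ((x : F) * LPphi q n k (x : F))⁻¹) = ∑ j, (a i * LPphi q n k (a j)) * 
      if (i = 0 ∧ k + j = k) ∨ (i = k ∧ k + j = 0) then -1 else 0 := by
    intro i
    rw [Finset.sum_comm]
    simp_rw [← Finset.mul_sum, LP_sum2 hF hq2 hn _ _ _ hk]
  simp_rw [h2]
  have h3 : ∀ i j : ZMod n, (a i * LPphi q n k (a j)) * 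
      (if (i = 0 ∧ k + j = k) ∨ (i = k ∧ k + j = 0) then (-1 : F) else 0) =
      (if i = 0 then (if j = 0 then -(a i * LPphi q n k (a j)) else 0) else 0) +
      (if i = k then (if j = -k then -(a i * LPphi q n k (a j)) else 0) else 0) := by
    intro i j
    have e1 : k + j = k ↔ j = 0 := by simp
    have e2 : k + j = 0 ↔ j = -k := by rw [add_comm]; exact add_eq_zero_iff_eq_neg
    simp only [e1, e2]
    by_cases h1 : i = 0
    · have : i ≠ k := fun h => hk (h ▸ h1)
      by_cases hj : j = 0 <;> simp [h1, hj, hk.symm]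
    · by_cases hj : j = -k <;> by_cases hi : i = k <;> simp [h1, hj, hi, hk]
  simp_rw [h3, Finset.sum_add_distrib]
  simp
  ring

end phi


/-- **No equivalence via the "inverse" map for `n > 4`.**
Let `n > 4`, `gcd(s,n) = gcd(t,n) = 1`, `1 ≤ s,t < n/2`, and let
`f(x) = x^{q^s} + θ x^{q^{n-s}}`, `g(x) = x^{q^t} + δ x^{q^{n-t}}` with
`N(θ), N(δ) ∉ {0,1}`.  If `f` is bijective on `F_{q^n}`, then there is no nonzero `c`
with `{c·x/f(x) : x ≠ 0} = {g(x)/x : x ≠ 0}`. -/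
theorem LP_no_inverse_equivalence (p r q n s t : ℕ) (hp : p.Prime) (hr : 0 < r)
    (hq : q = p ^ r) (hn : 4 < n)
    (hs1 : 1 ≤ s) (hs2 : 2 * s < n) (ht1 : 1 ≤ t) (ht2 : 2 * t < n)
    (hgs : Nat.gcd s n = 1) (hgt : Nat.gcd t n = 1)
    (F : Type*) [Field F] [Fintype F] (hF : Fintype.card F = q ^ n)
    (θ δ : F)
    (hθ0 : θ ^ ((q ^ n - 1) / (q - 1)) ≠ 0) (hθ1 : θ ^ ((q ^ n - 1) / (q - 1)) ≠ 1)
    (hδ0 : δ ^ ((q ^ n - 1) / (q - 1)) ≠ 0) (hδ1 : δ ^ ((q ^ n - 1) / (q - 1)) ≠ 1)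
    (hbij : Function.Bijective fun x : F => x ^ q ^ s + θ * x ^ q ^ (n - s)) :
    ¬ ∃ c : F, c ≠ 0 ∧
      {y : F | ∃ x : F, x ≠ 0 ∧ y = c * x / (x ^ q ^ s + θ * x ^ q ^ (n - s))} =
      {y : F | ∃ x : F, x ≠ 0 ∧ y = (x ^ q ^ t + δ * x ^ q ^ (n - t)) / x} := by
  classical
  rintro ⟨c, hc, hset⟩
  have hq2 : 2 ≤ q := by
    rw [hq]
    exact hp.two_le.trans (Nat.le_self_pow hr.ne' p)
  haveI : NeZero n := ⟨by omega⟩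
  haveI : Fact p.Prime := ⟨hp⟩
  have hF' : Fintype.card F = p ^ (r * n) := by rw [hF, hq, pow_mul]
  haveI : CharP F p := charP_of_card_eq_prime_pow hF'
  haveI : ExpChar F p := ExpChar.prime hp
  have hn3 : 3 ≤ n := by omega
  have hθ : θ ≠ 0 := by
    rintro rfl
    apply hθ0
    apply zero_pow
    intro h0
    have := Nat.div_eq_zero_iff.1 h0
    have h1 : q ^ 1 ≤ q ^ n := Nat.pow_le_pow_right (by omega) (by omega)
    rw [pow_one] at h1
    omega
  have cast_sub : ∀ m : ℕ, m < n → ((n - m : ℕ) : ZMod n) = -(m : ZMod n) := by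
    intro m hm
    rw [Nat.cast_sub hm.le]; simp
  -- the map `f` in terms of `LPphi`
  have hfx : ∀ x : F, x ^ q ^ s + θ * x ^ q ^ (n - s) =
      LPphi q n (s : ZMod n) x + θ * LPphi q n (-(s : ZMod n)) x := by
    intro x
    rw [← cast_sub s (by omega), LPphi_cast hF, LPphi_cast hF]
  have hgx : ∀ x : F, x ^ q ^ t + δ * x ^ q ^ (n - t) =
      LPphi q n (t : ZMod n) x + δ * LPphi q n (-(t : ZMod n)) x := by
    intro x
    rw [← cast_sub t (by omega), LPphi_cast hF, LPphi_cast hF]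
  simp only [hfx] at hbij hset
  simp only [hgx] at hset
  set S : ZMod n := (s : ZMod n) with hS
  set f : F → F := fun x => LPphi q n S x + θ * LPphi q n (-S) x with hf
  -- composition on coefficients
  let T : (ZMod n → F) → (ZMod n → F) := fun a i =>
    LPphi q n S (a (i - S)) + θ * LPphi q n (-S) (a (i + S))
  have hT : ∀ a x, LPlin hq hq2 (T a) x = f (LPlin hq hq2 a x) := by
    intro a x
    simp only [hf, LPlin_apply, LPphi_sum hq hq2, LPphi_mul, LPphi_comp hF, T, add_mul,
      Finset.sum_add_distrib]
    congr 1
    · refine Fintype.sum_equiv (Equiv.subRight S) _ _ fun i => ?_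
      simp
    · rw [Finset.mul_sum]
      refine Fintype.sum_equiv (Equiv.addRight S) _ _ fun i => ?_
      simp [mul_assoc]
  have hinj : Function.Injective T := by
    intro a b hab
    have h1 : ∀ x, LPlin hq hq2 a x = LPlin hq hq2 b x := by
      intro x
      apply hbij.1
      show f _ = f _
      rw [← hT, ← hT, hab]
    funext j
    have ha := LP_moment1 hq hq2 hF hn3 a j
    have hb := LP_moment1 hq hq2 hF hn3 b j
    simp only [h1] at ha
    exact neg_injective (ha.symm.trans hb)
  obtain ⟨h, hh⟩ := (Finite.injective_iff_surjective.1 hinj) (Pi.single 0 1)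
  have hfh : ∀ x, f (LPlin hq hq2 h x) = x := by
    intro x
    rw [← hT, hh, LPlin_apply, Finset.sum_eq_single 0]
    · simp [LPphi_zero]
    · intro i _ hi; simp [hi]
    · simp
  have hf0 : f 0 = 0 := by
    simp [hf, (LPphi_eq_zero hq2 _ (0 : F)).2 rfl]
  have hfz : ∀ x, f x = 0 → x = 0 := fun x hx => hbij.1 (show f x = f 0 by rw [hx, hf0])
  have hlinc : ∀ x, LPlin hq hq2 (fun i => c * h i) x = c * LPlin hq hq2 h x := by
    intro x; simp [LPlin_apply, Finset.mul_sum, mul_assoc]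
  let b : ZMod n → F := fun i => (if i = (t : ZMod n) then 1 else 0) +
    (if i = -(t : ZMod n) then δ else 0)
  have hlinb : ∀ x, LPlin hq hq2 b x =
      LPphi q n (t : ZMod n) x + δ * LPphi q n (-(t : ZMod n)) x := by
    intro x; simp [LPlin_apply, b, add_mul, Finset.sum_add_distrib]
  have hset' : ∀ y, (∃ x : F, x ≠ 0 ∧ y = LPlin hq hq2 (fun i => c * h i) x / x) ↔
      (∃ x : F, x ≠ 0 ∧ y = LPlin hq hq2 b x / x) := by
    intro y
    have h1 := Set.ext_iff.1 hset y
    simp only [Set.mem_setOf_eq] at h1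
    simp only [hlinb]
    rw [← h1]
    constructor
    · rintro ⟨x, hx, rfl⟩
      refine ⟨LPlin hq hq2 h x, ?_, ?_⟩
      · intro h0
        have := hfh x
        rw [h0, hf0] at this
        exact hx this.symm
      · have := hfh x
        simp only [hf] at this
        rw [this, hlinc]
    · rintro ⟨x, hx, rfl⟩
      refine ⟨f x, fun h0 => hx (hfz x h0), ?_⟩
      have : LPlin hq hq2 h (f x) = x := hbij.1 (hfh (f x))
      rw [hlinc, this]
  have hsum : ∀ P : F → F, ∑ x : Fˣ, P (LPlin hq hq2 (fun i => c * h i) x / x) =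
      ∑ x : Fˣ, P (LPlin hq hq2 b x / x) := by
    intro P
    rw [LP_fibre F p (r * n) hp hF', LP_fibre F p (r * n) hp hF']
    simp only [hset']
  have nz : ∀ m : ℕ, 0 < m → m < n → (m : ZMod n) ≠ 0 := by
    intro m h0 hm h1
    rw [ZMod.natCast_eq_zero_iff] at h1
    exact absurd (Nat.le_of_dvd h0 h1) (by omega)
  have ht0 : (t : ZMod n) ≠ 0 := nz t (by omega) (by omega)
  have hb0 : b 0 = 0 := by
    simp [b, ht0.symm, ht0]
  have hh0 : h 0 = 0 := by
    have h1 := hsum id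
    have ha := LP_moment1 hq hq2 hF hn3 (fun i => c * h i) 0
    have hb := LP_moment1 hq hq2 hF hn3 b 0
    simp only [LPphi_zero, ← div_eq_mul_inv] at ha hb
    simp only [id] at h1
    rw [ha, hb, hb0] at h1
    simpa [hc] using h1
  have hkey : ∀ k : ZMod n, k ≠ 0 → k ≠ t → k ≠ -(t : ZMod n) → h k = 0 ∨ h (-k) = 0 := by
    intro k hk h1 h2
    have h3 := hsum (fun y => y * LPphi q n k y)
    rw [LP_moment2 hq hq2 hF hn3 _ k hk, LP_moment2 hq hq2 hF hn3 _ k hk] at h3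
    have hbk : b k = 0 := by simp [b, h1, h2]
    rw [hb0, hbk] at h3
    simpa [hh0, hc, LPphi_eq_zero hq2] using h3
  -- recurrence
  have hrec : ∀ i : ZMod n, i ≠ 0 → (h (i - S) = 0 ↔ h (i + S) = 0) := by
    intro i hi
    have h1 := congrFun hh i
    simp only [T, Pi.single_eq_of_ne hi] at h1
    constructor
    · intro h2
      rw [h2, (LPphi_eq_zero hq2 _ (0 : F)).2 rfl] at h1
      simpa [hθ, LPphi_eq_zero hq2] using h1
    · intro h2
      rw [h2, (LPphi_eq_zero hq2 _ (0 : F)).2 rfl] at h1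
      simpa [LPphi_eq_zero hq2] using h1
  have hne : ¬ (h S = 0 ∧ h (-S) = 0) := by
    rintro ⟨h2, h3⟩
    have h1 := congrFun hh 0
    simp [T, h2, h3, (LPphi_eq_zero hq2 _ (0 : F)).2 rfl] at h1
  have hunit : ∀ m : ℕ, (m : ZMod n) * S = 0 → n ∣ m := by
    intro m hm
    rw [hS, ← Nat.cast_mul, ZMod.natCast_eq_zero_iff] at hm
    exact (Nat.Coprime.symm hgs).dvd_of_dvd_mul_right hm
  let Z : ℕ → Prop := fun j => h ((j : ZMod n) * S) = 0
  have hZ : ∀ j, j + 1 < n → (Z j ↔ Z (j + 2)) := by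
    intro j hj
    have h1 := hrec (((j + 1 : ℕ) : ZMod n) * S) (fun h0 =>
      absurd (Nat.le_of_dvd (by omega) (hunit _ h0)) (by omega))
    have e1 : ((j + 1 : ℕ) : ZMod n) * S - S = (j : ZMod n) * S := by push_cast; ring
    have e2 : ((j + 1 : ℕ) : ZMod n) * S + S = ((j + 2 : ℕ) : ZMod n) * S := by push_cast; ring
    rw [e1, e2] at h1
    exact h1
  have hZodd : ∀ m, 2 * m + 1 ≤ n → (Z 1 ↔ Z (2 * m + 1)) := by
    intro m
    induction m with
    | zero => intro _; rfl
    | succ m ih =>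
      intro hm
      rw [ih (by omega)]
      exact hZ (2 * m + 1) (by omega)
  have hZeven : ∀ m, 2 * m ≤ n → (Z 0 ↔ Z (2 * m)) := by
    intro m
    induction m with
    | zero => intro _; rfl
    | succ m ih =>
      intro hm
      rw [ih (by omega)]
      exact hZ (2 * m) (by omega)
  have hZneg : ∀ j, j ≤ n → (Z (n - j) ↔ h (-((j : ZMod n) * S)) = 0) := by
    intro j hj
    simp only [Z]
    rw [Nat.cast_sub hj, ZMod.natCast_self, zero_sub, neg_mul]
  have hZ1 : Z 1 ↔ h S = 0 := by simp [Z]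
  have hZ1' : Z (n - 1) ↔ h (-S) = 0 := by rw [hZneg 1 (by omega)]; simp
  have hZ0 : Z 0 := by simpa [Z] using hh0
  have hZn : Z n := by simpa [Z] using hh0
  rcases Nat.even_or_odd' n with ⟨m, hm | hm⟩
  · -- even case
    have a1 := hZodd (m - 1) (by omega)
    rw [show 2 * (m - 1) + 1 = n - 1 by omega] at a1
    have hnz1 : ¬ Z 1 := fun hz => hne ⟨hZ1.1 hz, hZ1'.1 (a1.1 hz)⟩
    have hnz1' : ¬ Z (n - 1) := fun hz => hnz1 (a1.2 hz)
    have hnz3 : ¬ Z 3 := fun hz => hnz1 ((hZodd 1 (by omega)).2 hz)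
    have a3 := hZodd (m - 2) (by omega)
    rw [show 2 * (m - 2) + 1 = n - 3 by omega] at a3
    have hnz3' : ¬ Z (n - 3) := fun hz => hnz1 (a3.2 hz)
    have hn0 : ∀ j : ℕ, 0 < j → j < n → (j : ZMod n) * S ≠ 0 := fun j h0 hj h1 =>
      absurd (Nat.le_of_dvd h0 (hunit j h1)) (by omega)
    have k1 : S = t ∨ S = -(t : ZMod n) := by
      by_contra hcon
      push Not at hcon
      rcases hkey S (by simpa using hn0 1 (by omega) (by omega)) hcon.1 hcon.2 with h1 | h1
      · exact hnz1 (hZ1.2 h1)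
      · exact hnz1' (hZ1'.2 h1)
    have k3 : ((3 : ℕ) : ZMod n) * S = t ∨ ((3 : ℕ) : ZMod n) * S = -(t : ZMod n) := by
      by_contra hcon
      push Not at hcon
      rcases hkey _ (hn0 3 (by omega) (by omega)) hcon.1 hcon.2 with h1 | h1
      · exact hnz3 h1
      · exact hnz3' ((hZneg 3 (by omega)).2 h1)
    have n2 := hn0 2 (by omega) (by omega)
    have n4 := hn0 4 (by omega) (by omega)
    push_cast at k3 n2 n4
    rcases k1 with k1 | k1 <;> rcases k3 with k3 | k3
    · apply n2; linear_combination k3 - k1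
    · apply n4; linear_combination k3 + k1
    · apply n4; linear_combination k3 + k1
    · apply n2; linear_combination k3 - k1
  · -- odd case
    have a1 := hZodd m (by omega)
    rw [← hm] at a1
    have a2 := hZeven m (by omega)
    rw [show 2 * m = n - 1 by omega] at a2
    exact hne ⟨hZ1.1 (a1.2 hZn), hZ1'.1 (a2.1 hZ0)⟩
end

section
/- Let q be a prime power and let θ, δ ∈ F_{q^4} satisfy N_{q^4/q}(θ) ∉ {0,1} and N_{q^4/q}(δ) ∉ {0,1}. Set f(x) = x^q + θ·x^{q³} and g(x) = x^q + δ·x^{q³}. Then there exists c ∈ F_{q^4} with {c·x/f(x) : x ∈ F_{q^4}^*} = {g(x)/x : x ∈ F_{q^4}^*} if and only if θ^{q²+1} ∈ {δ^{q²+1}, δ^{−(q³+q)}}. Moreover, when this condition is satisfied, the number of c ∈ F_{q^4} for which the displayed equality holds is exactly q+1. -/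
open Finset in
/-- Power sums over the units vanish for exponents not divisible by `|F| - 1`. -/
lemma aux_sum_ratio {F : Type*} [Field F] [Fintype F] [DecidableEq F] (a b : ℕ) (hab : a < b)
    (hb : b - a < Fintype.card F - 1) :
    (∑ x : Fˣ, (x : F) ^ b / (x : F) ^ a = 0) ∧ (∑ x : Fˣ, (x : F) ^ a / (x : F) ^ b = 0) := by
  have h1 : ∑ x : Fˣ, (x : F) ^ b / (x : F) ^ a = 0 := by
    have h := FiniteField.sum_pow_units F (b - a)
    rw [if_neg (fun hd => by have := Nat.le_of_dvd (by omega) hd; omega)] at h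
    rw [← h]
    refine Finset.sum_congr rfl fun x _ => ?_
    rw [div_eq_iff (pow_ne_zero _ x.ne_zero), ← pow_add]
    congr 1; omega
  refine ⟨h1, ?_⟩
  rw [← h1]
  refine Fintype.sum_equiv (Equiv.inv Fˣ) _ _ fun x => ?_
  simp only [Equiv.inv_apply, Units.val_inv_eq_inv_val, inv_pow]
  rw [div_eq_mul_inv, div_eq_mul_inv, inv_inv, mul_comm]

/-- The set `{(a x^σ + b x^{σ³})/x}`. -/
def auxL {F : Type*} [Field F] (σ : F →+* F) (a b : F) : Set F :=
  {y | ∃ x : F, x ≠ 0 ∧ y = (a * σ x + b * σ (σ (σ x))) / x}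

section
variable {F : Type*} [Field F] [Fintype F] {p q : ℕ} {σ : F →+* F}

lemma aux_num (hq : 2 ≤ q) : q < q ^ 2 ∧ q ^ 2 < q ^ 3 ∧ 2 * q ^ 3 ≤ q ^ 4 ∧
    q + q ^ 2 < q ^ 3 + 1 := by
  refine ⟨by nlinarith, by nlinarith [sq_nonneg q], ?_, ?_⟩
  · rw [pow_succ q 3]; nlinarith [pow_pos (show 0 < q by omega) 3]
  · obtain ⟨k, rfl⟩ := Nat.exists_eq_add_of_le hq
    ring_nf
    nlinarith [sq_nonneg k, pow_nonneg (Nat.zero_le k) 3]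

lemma aux_sums (hq : 2 ≤ q) (hF : Fintype.card F = q ^ 4) (hσ : ∀ x, σ x = x ^ q) 
    [DecidableEq F] :
    (∑ x : Fˣ, σ x / (x : F) = 0) ∧ (∑ x : Fˣ, σ (σ x) / (x : F) = 0) ∧
    (∑ x : Fˣ, σ (σ (σ x)) / (x : F) = 0) ∧
    (∑ x : Fˣ, (x : F) / σ (σ x) = 0) ∧
    (∑ x : Fˣ, σ (σ (σ x)) / σ x = 0) ∧
    (∑ x : Fˣ, σ x / σ (σ (σ x)) = 0) ∧
    (∑ x : Fˣ, (σ (σ (σ x)) * σ (σ x)) / (σ x * x) = 0) ∧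
    (∑ x : Fˣ, (σ x * x) / (σ (σ (σ x)) * σ (σ x)) = 0) ∧
    (∑ x : Fˣ, (σ (σ (σ x)) * x) / (σ x * σ (σ x)) = 0) ∧
    (∑ x : Fˣ, (σ x * σ (σ x)) / (σ (σ (σ x)) * x) = 0) := by
  obtain ⟨n1, n2, n3, n4⟩ := aux_num hq
  have h3 : q ^ 3 ≥ 8 := by
    calc q ^ 3 ≥ 2 ^ 3 := Nat.pow_le_pow_left hq 3
      _ = 8 := by norm_num
  have e2 : ∀ x, σ (σ x) = x ^ (q ^ 2) := fun x => by rw [hσ, hσ, ← pow_mul]; ring_nf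
  have e3 : ∀ x, σ (σ (σ x)) = x ^ (q ^ 3) := fun x => by rw [hσ, e2, ← pow_mul]; ring_nf
  have k1 := aux_sum_ratio (F := F) 1 q (by omega) (by omega)
  have k2 := aux_sum_ratio (F := F) 1 (q ^ 2) (by omega) (by omega)
  have k3 := aux_sum_ratio (F := F) 1 (q ^ 3) (by omega) (by omega)
  have k4 := aux_sum_ratio (F := F) q (q ^ 3) (by omega) (by omega)
  have k5 := aux_sum_ratio (F := F) (q + 1) (q ^ 3 + q ^ 2) (by omega) (by omega)
  have k6 := aux_sum_ratio (F := F) (q + q ^ 2) (q ^ 3 + 1) (by omega) (by omega)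
  simp only [pow_add, pow_one] at k1 k2 k3 k4 k5 k6
  simp only [e3]
  simp only [e2]
  simp only [hσ]
  exact ⟨k1.1, k2.1, k3.1, k2.2, k4.1, k4.2, k5.1, k5.2, k6.1, k6.2⟩

lemma aux_card_units (hq : 2 ≤ q) (hF : Fintype.card F = q ^ 4) [DecidableEq F] (c : F) :
    ∑ _x : Fˣ, c = -c := by
  have h := FiniteField.sum_pow_units F 0
  simp only [pow_zero, dvd_zero, if_true] at h
  have : ∑ _x : Fˣ, c = (∑ _x : Fˣ, (1 : F)) * c := by rw [Finset.sum_mul]; simp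
  rw [this, h]; ring

/-- Some element has nonzero trace. -/
lemma aux_trace (hq : 2 ≤ q) (hF : Fintype.card F = q ^ 4) (hσ : ∀ x, σ x = x ^ q) :
    ∃ x : F, x + σ x + σ (σ x) + σ (σ (σ x)) ≠ 0 := by
  classical
  by_contra! h
  obtain ⟨s1, s2, s3, -⟩ := aux_sums hq hF hσ
  have : ∑ x : Fˣ, ((1 : F) + σ x / (x : F) + σ (σ x) / (x : F) + σ (σ (σ x)) / (x : F)) = 0 := by
    refine Finset.sum_eq_zero fun x _ => ?_
    have := x.ne_zero
    have h2 := h x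
    field_simp
    linear_combination h2
  rw [Finset.sum_add_distrib, Finset.sum_add_distrib, Finset.sum_add_distrib, s1, s2, s3,
    aux_card_units hq hF] at this
  simp at this

lemma aux_adj_sub (hq : 2 ≤ q) (hF : Fintype.card F = q ^ 4) (hσ : ∀ x, σ x = x ^ q)
    (h4 : ∀ x, σ (σ (σ (σ x))) = x) (a b : F) :
    auxL σ (σ b) (σ (σ (σ a))) ⊆ auxL σ a b := by
  rintro m ⟨y, hy, rfl⟩
  set m := (σ b * σ y + σ (σ (σ a)) * σ (σ (σ y))) / y with hm
  have hm' : m * y = σ b * σ y + σ (σ (σ a)) * σ (σ (σ y)) := by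
    rw [hm]; field_simp
  by_contra hcon
  have hno : ∀ x, a * σ x + b * σ (σ (σ x)) - m * x = 0 → x = 0 := by
    intro x hx
    by_contra hx0
    refine hcon ⟨x, hx0, ?_⟩
    field_simp
    linear_combination -hx
  have hinj : Function.Injective (fun x => a * σ x + b * σ (σ (σ x)) - m * x) := by
    intro x z hxz
    have := hno (x - z) (by simp only [map_sub]; linear_combination hxz)
    exact sub_eq_zero.mp this
  obtain ⟨t, ht⟩ := aux_trace hq hF hσ
  obtain ⟨x, hx⟩ := (Finite.surjective_of_injective hinj) (t / y)
  apply ht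
  have hty : t = y * (a * σ x + b * σ (σ (σ x)) - m * x) := by
    simp only at hx; rw [hx]; field_simp
  rw [hty]
  have g1 := congrArg σ hm'
  have g2 := congrArg σ g1
  have g3 := congrArg σ g2
  simp only [map_add, map_mul, h4, map_sub] at g1 g2 g3 ⊢
  linear_combination (-x) * hm' - σ x * g1 - σ (σ x) * g2 - σ (σ (σ x)) * g3

lemma aux_adj (hq : 2 ≤ q) (hF : Fintype.card F = q ^ 4) (hσ : ∀ x, σ x = x ^ q)
    (h4 : ∀ x, σ (σ (σ (σ x))) = x) (a b : F) :
    auxL σ (σ b) (σ (σ (σ a))) = auxL σ a b := by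
  refine le_antisymm (aux_adj_sub hq hF hσ h4 a b) ?_
  have := aux_adj_sub hq hF hσ h4 (σ b) (σ (σ (σ a)))
  rwa [h4, h4] at this

lemma aux_smul (c a b : F) :
    auxL σ (c * a) (c * b) = (fun y => c * y) '' auxL σ a b := by
  ext y
  constructor
  · rintro ⟨x, hx, rfl⟩
    exact ⟨_, ⟨x, hx, rfl⟩, by ring⟩
  · rintro ⟨_, ⟨x, hx, rfl⟩, rfl⟩
    exact ⟨x, hx, by ring⟩

lemma aux_subst_sub (a b α : F) (hα : α ≠ 0) :
    auxL σ (a * σ α / α) (b * σ (σ (σ α)) / α) ⊆ auxL σ a b := by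
  rintro y ⟨x, hx, rfl⟩
  refine ⟨α * x, mul_ne_zero hα hx, ?_⟩
  simp only [map_mul]
  field_simp

lemma aux_subst (a b α : F) (hα : α ≠ 0) :
    auxL σ (a * σ α / α) (b * σ (σ (σ α)) / α) = auxL σ a b := by
  refine le_antisymm (aux_subst_sub a b α hα) ?_
  have := aux_subst_sub (σ := σ) (a * σ α / α) (b * σ (σ (σ α)) / α) α⁻¹ (inv_ne_zero hα)
  have e : ∀ z, σ z ≠ 0 ↔ z ≠ 0 := fun z => map_ne_zero σ
  have h1 : σ α ≠ 0 := (e _).2 hα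
  have h2 : σ (σ (σ α)) ≠ 0 := (e _).2 ((e _).2 h1)
  have k1 : a * σ α / α * σ α⁻¹ / α⁻¹ = a := by
    simp only [map_inv₀]; field_simp
  have k2 : b * σ (σ (σ α)) / α * σ (σ (σ α⁻¹)) / α⁻¹ = b := by
    simp only [map_inv₀]; field_simp
  rwa [k1, k2] at this

/-- Power sums over the set computed through the parametrisation. -/
lemma aux_fiber [CharP F p] (hp : p.Prime) {r : ℕ} (hF : Fintype.card F = p ^ r)
    [DecidableEq F] (a b : F) (φ : F → F) [DecidablePred (· ∈ auxL σ a b)] :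
    ∑ x : Fˣ, φ ((a * σ x + b * σ (σ (σ x))) / x) =
      ∑ m : F, if m ∈ auxL σ a b then - φ m else 0 := by
  rw [← Finset.sum_fiberwise (Finset.univ) (fun x : Fˣ => (a * σ x + b * σ (σ (σ x))) / x)]
  refine Finset.sum_congr rfl fun m _ => ?_
  rw [Finset.sum_congr rfl (g := fun _ => φ m)
    (fun x hx => by rw [(Finset.mem_filter.1 hx).2])]
  rw [Finset.sum_const, nsmul_eq_mul]
  split_ifs with hm
  · obtain ⟨x0, hx0, hm⟩ := hm
    let K : AddSubgroup F :=
      { carrier := {x | a * σ x + b * σ (σ (σ x)) = m * x}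
        zero_mem' := by simp
        add_mem' := by
          intro x y hx hy
          simp only [Set.mem_ofPred_eq, map_add] at *
          linear_combination hx + hy
        neg_mem' := by
          intro x hx
          simp only [Set.mem_ofPred_eq, map_neg] at *
          linear_combination - hx }
    have hx0K : x0 ∈ K := by
      change a * σ x0 + b * σ (σ (σ x0)) = m * x0
      rw [hm]; field_simp
    have hdvd : Nat.card K ∣ p ^ r := by
      rw [← hF, ← Nat.card_eq_fintype_card]; exact K.card_addSubgroup_dvd_card
    have hne : Nat.card K ≠ 1 := by
      intro h1
      have := (AddSubgroup.eq_bot_of_card_eq K h1)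
      rw [this] at hx0K
      exact hx0 (by simpa using hx0K)
    have hpK : p ∣ Nat.card K := by
      obtain ⟨k, -, hk⟩ := (Nat.dvd_prime_pow hp).1 hdvd
      rw [hk] at hne ⊢
      exact dvd_pow_self p (by rintro rfl; simp at hne)
    have hK0 : ((Nat.card K : ℕ) : F) = 0 := (CharP.cast_eq_zero_iff F p _).2 hpK
    have hcard : Nat.card K =
        (Finset.univ.filter (fun x : Fˣ => (a * σ x + b * σ (σ (σ x))) / x = m)).card + 1 := by
      have h1 : (K : Set F) = ((insert 0 ((Finset.univ.filter
          (fun x : Fˣ => (a * σ x + b * σ (σ (σ x))) / x = m)).map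
            ⟨Units.val, Units.val_injective⟩) : Finset F) : Set F) := by
        ext x
        simp only [Finset.coe_insert, Finset.coe_map, Set.mem_insert_iff, Set.mem_image,
          Finset.mem_coe, Finset.mem_filter, Finset.mem_univ, true_and,
          Function.Embedding.coeFn_mk, SetLike.mem_coe]
        change a * σ x + b * σ (σ (σ x)) = m * x ↔ _
        constructor
        · intro hx
          by_cases h0 : x = 0
          · exact Or.inl h0
          · refine Or.inr ⟨Units.mk0 x h0, ?_, rfl⟩
            simp only [Units.val_mk0]
            rw [hx]; field_simp
        · rintro (rfl | ⟨u, hu, rfl⟩)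
          · simp
          · rw [← hu]
            have := u.ne_zero
            field_simp
      have h2 : Nat.card K = (K : Set F).ncard := rfl
      rw [h2, h1, Set.ncard_coe_finset, Finset.card_insert_of_notMem, Finset.card_map]
      simp
    rw [hcard] at hK0
    push_cast at hK0
    linear_combination φ m * hK0
  · rw [Finset.filter_eq_empty_iff.2]
    · simp
    · intro x _ hx
      exact hm ⟨x, x.ne_zero, hx.symm⟩

lemma aux_sum_eq [CharP F p] (hp : p.Prime) {r : ℕ} (hF : Fintype.card F = p ^ r)
    [DecidableEq F] (a b a' b' : F) (h : auxL σ a b = auxL σ a' b') (φ : F → F) :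
    ∑ x : Fˣ, φ ((a * σ x + b * σ (σ (σ x))) / x) =
      ∑ x : Fˣ, φ ((a' * σ x + b' * σ (σ (σ x))) / x) := by
  classical
  rw [aux_fiber hp hF, aux_fiber hp hF, h]

lemma aux_powA (hq : 2 ≤ q) (hF : Fintype.card F = q ^ 4) (hσ : ∀ x, σ x = x ^ q)
    (h4 : ∀ x, σ (σ (σ (σ x))) = x) [DecidableEq F] (a b : F) :
    ∑ x : Fˣ, (fun y => y * σ y) ((a * σ x + b * σ (σ (σ x))) / x) = - (a * σ b) := by
  obtain ⟨s1, s2, s3, s4, s5, s6, s7, s8, s9, s10⟩ := aux_sums hq hF hσ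
  have : ∀ x : Fˣ, (fun y => y * σ y) ((a * σ x + b * σ (σ (σ x))) / (x : F)) =
      a * σ b + a * σ a * (σ (σ x) / (x : F)) + b * σ b * (σ (σ (σ x)) / σ x) +
      b * σ a * ((σ (σ (σ x)) * σ (σ x)) / (σ x * x)) := by
    intro x
    have h0 := x.ne_zero
    have h1 : σ x ≠ 0 := (map_ne_zero σ).2 h0
    simp only [map_div₀, map_add, map_mul, h4]
    field_simp
    ring
  simp only [this]
  simp only [Finset.sum_add_distrib, ← Finset.mul_sum, s2, s5, s7, aux_card_units hq hF]
  ring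

lemma aux_powB (hq : 2 ≤ q) (hF : Fintype.card F = q ^ 4) (hσ : ∀ x, σ x = x ^ q)
    (h4 : ∀ x, σ (σ (σ (σ x))) = x) [DecidableEq F] (a b : F) :
    ∑ x : Fˣ, (fun y => y * σ y * σ (σ y) * σ (σ (σ y)))
        ((a * σ x + b * σ (σ (σ x))) / x) =
      - ((a * σ (σ a) + b * σ (σ b)) * σ (a * σ (σ a) + b * σ (σ b))) := by
  obtain ⟨s1, s2, s3, s4, s5, s6, s7, s8, s9, s10⟩ := aux_sums hq hF hσ
  have : ∀ x : Fˣ, (fun y => y * σ y * σ (σ y) * σ (σ (σ y)))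
        ((a * σ x + b * σ (σ (σ x))) / (x : F)) =
      (a * σ (σ a) + b * σ (σ b)) * σ (a * σ (σ a) + b * σ (σ b))
      + (σ (a * σ (σ a) + b * σ (σ b)) * (a * σ (σ b))) * (σ x / σ (σ (σ x)))
      + (σ (a * σ (σ a) + b * σ (σ b)) * (b * σ (σ a))) * (σ (σ (σ x)) / σ x)
      + ((a * σ (σ a) + b * σ (σ b)) * (σ a * σ (σ (σ b)))) * (σ (σ x) / (x : F))
      + ((a * σ (σ a) + b * σ (σ b)) * (σ b * σ (σ (σ a)))) * ((x : F) / σ (σ x))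
      + ((a * σ (σ b)) * (σ a * σ (σ (σ b)))) * ((σ x * σ (σ x)) / (σ (σ (σ x)) * x))
      + ((a * σ (σ b)) * (σ b * σ (σ (σ a)))) * ((σ x * x) / (σ (σ (σ x)) * σ (σ x)))
      + ((b * σ (σ a)) * (σ a * σ (σ (σ b)))) * ((σ (σ (σ x)) * σ (σ x)) / (σ x * x))
      + ((b * σ (σ a)) * (σ b * σ (σ (σ a)))) * ((σ (σ (σ x)) * x) / (σ x * σ (σ x))) := by
    intro x
    have h0 := x.ne_zero
    have h1 : σ x ≠ 0 := (map_ne_zero σ).2 h0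
    have h2 : σ (σ x) ≠ 0 := (map_ne_zero σ).2 h1
    have h3 : σ (σ (σ x)) ≠ 0 := (map_ne_zero σ).2 h2
    simp only [map_div₀, map_add, map_mul, h4]
    generalize σ (σ (σ (x : F))) = x3 at *
    generalize σ (σ (x : F)) = x2 at *
    generalize σ (x : F) = x1 at *
    generalize (x : F) = x0 at *
    field_simp
    ring
  simp only [this]
  simp only [Finset.sum_add_distrib, ← Finset.mul_sum, s2, s4, s5, s6, s7, s8, s9, s10,
    aux_card_units hq hF]
  ring

lemma aux_necessity [CharP F p] (hp : p.Prime) {r : ℕ} (hF' : Fintype.card F = p ^ r)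
    (hq : 2 ≤ q) (hF : Fintype.card F = q ^ 4) (hσ : ∀ x, σ x = x ^ q)
    (h4 : ∀ x, σ (σ (σ (σ x))) = x) (l η δ : F) (hη : η ≠ 0) 
    (h : auxL σ l (l * η) = auxL σ 1 δ) :
    l * σ l * σ η = σ δ ∧
    (η * σ (σ η) = δ * σ (σ δ) ∨ (η * σ (σ η)) * σ (δ * σ (σ δ)) = 1) := by
  classical
  have A := aux_sum_eq hp hF' _ _ _ _ h (fun y => y * σ y)
  have B := aux_sum_eq hp hF' _ _ _ _ h (fun y => y * σ y * σ (σ y) * σ (σ (σ y)))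
  rw [aux_powA hq hF hσ h4, aux_powA hq hF hσ h4] at A
  rw [aux_powB hq hF hσ h4, aux_powB hq hF hσ h4] at B
  have A1 : l * σ l * σ η = σ δ := by
    rw [map_mul] at A
    linear_combination -A
  refine ⟨A1, ?_⟩
  have A2 := congrArg σ A1
  have A3 := congrArg σ A2
  have A4 := congrArg σ A3
  simp only [map_mul, map_add, map_one, h4] at A A2 A3 A4 B ⊢
  have h1 : σ η ≠ 0 := (map_ne_zero σ).2 hη
  have h2 : σ (σ η) ≠ 0 := (map_ne_zero σ).2 h1
  have h3 : σ (σ (σ η)) ≠ 0 := (map_ne_zero σ).2 h2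
  generalize σ (σ (σ η)) = η3 at *
  generalize σ (σ η) = η2 at *
  generalize σ η = η1 at *
  generalize σ (σ (σ δ)) = δ3 at *
  generalize σ (σ δ) = δ2 at *
  generalize σ δ = δ1 at *
  generalize σ (σ (σ l)) = l3 at *
  generalize σ (σ l) = l2 at *
  generalize σ l = l1 at *
  -- the norm of l
  obtain ⟨n, hn⟩ : ∃ n, n = l * l1 * l2 * l3 := ⟨_, rfl⟩
  have D0 : δ * δ2 = n * (η * η2) := by
    rw [← A2, ← A4, hn]; ring
  have D1 : δ1 * δ3 = n * (η1 * η3) := by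
    rw [← A1, ← A3, hn]; ring
  have key : (n - 1) * (1 - n * (η * η2) * (η1 * η3)) = 0 := by
    have : n * (1 + η * η2) * (1 + η1 * η3) = (1 + δ * δ2) * (1 + δ1 * δ3) := by
      rw [hn]; linear_combination -B
    rw [D0, D1] at this
    linear_combination this
  rcases mul_eq_zero.1 key with k | k
  · left
    rw [D0]; linear_combination (-η * η2) * k
  · right
    rw [D1]; linear_combination -k

lemma aux_gen (hq : 2 ≤ q) (hF : Fintype.card F = q ^ 4) :
    ∃ ζ : F, IsPrimitiveRoot ζ (q ^ 4 - 1) ∧ ∀ u : F, u ≠ 0 → ∃ i : ℕ, u = ζ ^ i := by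
  classical
  obtain ⟨g, hg⟩ := IsCyclic.exists_generator (α := Fˣ)
  refine ⟨g, ?_, ?_⟩
  · have h1 : orderOf g = q ^ 4 - 1 := by
      rw [orderOf_eq_card_of_forall_mem_zpowers hg, Nat.card_eq_fintype_card,
        Fintype.card_units, hF]
    have := IsPrimitiveRoot.orderOf g
    rw [h1] at this
    exact IsPrimitiveRoot.coe_units_iff.2 this
  · intro u hu
    have := hg (Units.mk0 u hu)
    rw [← mem_powers_iff_mem_zpowers] at this
    obtain ⟨i, hi⟩ := this
    refine ⟨i, ?_⟩
    have := congrArg Units.val hi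
    simpa using this.symm

lemma aux_root (hq : 2 ≤ q) (hF : Fintype.card F = q ^ 4) (m k : ℕ) (hmk : q ^ 4 - 1 = m * k)
    (u : F) (hu : u ^ k = 1) : ∃ v, v ^ m = u := by
  obtain ⟨ζ, hζ, hgen⟩ := aux_gen hq hF
  have hpos : 0 < q ^ 4 - 1 := by
    have := Nat.pow_le_pow_left hq 4
    omega
  have hk : 0 < k := Nat.pos_of_ne_zero (by rintro rfl; simp at hmk; omega)
  have hu0 : u ≠ 0 := by
    rintro rfl
    rw [zero_pow hk.ne'] at hu
    exact zero_ne_one hu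
  obtain ⟨i, rfl⟩ := hgen u hu0
  rw [← pow_mul, hζ.pow_eq_one_iff_dvd, hmk] at hu
  obtain ⟨j, rfl⟩ := Nat.dvd_of_mul_dvd_mul_right hk hu
  exact ⟨ζ ^ j, by rw [← pow_mul, mul_comm]⟩

lemma aux_fact (hq : 2 ≤ q) : q ^ 4 - 1 = (q - 1) * (1 + q + q ^ 2 + q ^ 3) ∧
    q ^ 4 - 1 = (q + 1) * ((q ^ 2 + 1) * (q - 1)) := by
  obtain ⟨k, rfl⟩ := Nat.exists_eq_add_of_le hq
  have h : 2 + k - 1 = k + 1 := by omega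
  rw [h]
  constructor
  · apply Nat.sub_eq_of_eq_add; ring
  · apply Nat.sub_eq_of_eq_add; ring

lemma aux_suff1 (hq : 2 ≤ q) (hF : Fintype.card F = q ^ 4) (hσ : ∀ x, σ x = x ^ q)
    (h4 : ∀ x, σ (σ (σ (σ x))) = x) (l η δ : F) (hη : η ≠ 0) (hδ : δ ≠ 0)
    (hl : l * σ l * σ η = σ δ) (hc : η * σ (σ η) = δ * σ (σ δ)) :
    auxL σ l (l * η) = auxL σ 1 δ := by
  have h1 : σ η ≠ 0 := (map_ne_zero σ).2 hη
  have h2 : σ (σ η) ≠ 0 := (map_ne_zero σ).2 h1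
  have h3 : σ (σ (σ η)) ≠ 0 := (map_ne_zero σ).2 h2
  have hN : l * σ l * σ (σ l) * σ (σ (σ l)) = 1 := by
    have a3 := congrArg σ (congrArg σ hl)
    have c1 := congrArg σ hc
    simp only [map_mul] at a3 c1
    have : (l * σ l * σ (σ l) * σ (σ (σ l)) - 1) * (σ η * σ (σ (σ η))) = 0 := by
      linear_combination a3 * σ δ + hl * (σ (σ l) * σ (σ (σ l)) * σ (σ (σ η))) - c1
    rcases mul_eq_zero.1 this with h | h
    · linear_combination h
    · exact absurd h (mul_ne_zero h1 h3)
  have hN' : l ^ (1 + q + q ^ 2 + q ^ 3) = 1 := by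
    rw [← hN]
    simp only [hσ, ← pow_mul]
    ring
  obtain ⟨α, hα⟩ := aux_root hq hF _ _ (aux_fact hq).1 l hN'
  have hα0 : α ≠ 0 := by
    rintro rfl
    rw [zero_pow (by omega)] at hα
    rw [← hα] at hN; simp at hN
  have hlα : σ α = l * α := by
    rw [hσ, ← hα, ← pow_succ]; congr 1; omega
  rw [← aux_subst 1 δ α hα0]
  have e1 : 1 * σ α / α = l := by rw [hlα]; field_simp
  have e2 : δ * σ (σ (σ α)) / α = l * η := by
    have a2 := congrArg σ hl
    simp only [map_mul] at a2
    simp only [hlα, map_mul]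
    field_simp
    apply mul_right_cancel₀ h2
    linear_combination (δ * l) * a2 - l * hc
  rw [e1, e2]

lemma aux_suff (hq : 2 ≤ q) (hF : Fintype.card F = q ^ 4) (hσ : ∀ x, σ x = x ^ q)
    (h4 : ∀ x, σ (σ (σ (σ x))) = x) (l η δ : F) (hη : η ≠ 0) (hδ : δ ≠ 0)
    (hl : l * σ l * σ η = σ δ)
    (hc : η * σ (σ η) = δ * σ (σ δ) ∨ (η * σ (σ η)) * σ (δ * σ (σ δ)) = 1) :
    auxL σ l (l * η) = auxL σ 1 δ := by
  rcases hc with hc | hc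
  · exact aux_suff1 hq hF hσ h4 l η δ hη hδ hl hc
  · have h1 : σ δ ≠ 0 := (map_ne_zero σ).2 hδ
    have h2 : σ (σ δ) ≠ 0 := (map_ne_zero σ).2 h1
    have h3 : σ (σ (σ δ)) ≠ 0 := (map_ne_zero σ).2 h2
    have key := aux_suff1 hq hF hσ h4 (l / σ δ) η (1 / σ δ) hη (by simpa using h1)
      (by simp only [map_div₀, map_one]; field_simp; linear_combination hl)
      (by simp only [map_div₀, map_one]; simp only [map_mul] at hc; field_simp;
          linear_combination hc)
    have := congrArg (fun S => (fun y => σ δ * y) '' S) key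
    simp only [← aux_smul] at this
    have e1 : σ δ * (l / σ δ) = l := by field_simp
    have e2 : σ δ * (l / σ δ * η) = l * η := by field_simp
    have e3 : σ δ * (1 / σ δ) = 1 := by field_simp
    rw [e1, e2, e3, mul_one] at this
    rw [this, ← aux_adj hq hF hσ h4 1 δ]
    simp

lemma aux_inverse (hq : 2 ≤ q) (hF : Fintype.card F = q ^ 4) (hσ : ∀ x, σ x = x ^ q)
    (h4 : ∀ x, σ (σ (σ (σ x))) = x) (θ c : F) (hθ : 1 - θ * σ (σ θ) ≠ 0) :
    {y : F | ∃ x : F, x ≠ 0 ∧ y = c * x / (σ x + θ * σ (σ (σ x)))} =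
      auxL σ (c / (1 - σ θ * σ (σ (σ θ)))) (c / (1 - σ θ * σ (σ (σ θ))) * (- σ (σ θ))) := by
  have hB : 1 - σ θ * σ (σ (σ θ)) ≠ 0 := by
    have := (map_ne_zero σ).2 hθ
    simpa using this
  have e := aux_smul (σ := σ) (c / (1 - σ θ * σ (σ (σ θ)))) 1 (- σ (σ θ))
  rw [mul_one] at e
  have e' := aux_adj hq hF hσ h4 (- σ (σ (σ θ))) 1
  simp only [map_one, map_neg, h4] at e'
  rw [e, e', ← aux_smul]
  have hf0 : ∀ x, x ≠ 0 → σ x + θ * σ (σ (σ x)) ≠ 0 := by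
    intro x hx h0
    have g := congrArg σ (congrArg σ h0)
    simp only [map_add, map_mul, map_zero, h4] at g
    have : (1 - θ * σ (σ θ)) * σ x = 0 := by linear_combination h0 - θ * g
    rcases mul_eq_zero.1 this with h | h
    · exact hθ h
    · exact hx ((map_eq_zero σ).1 h)
  have hg0 : ∀ y, y ≠ 0 → σ (σ (σ y)) - σ (σ (σ θ)) * σ y ≠ 0 := by
    intro y hy h0
    have g := congrArg σ (congrArg σ h0)
    simp only [map_sub, map_mul, map_zero, h4] at g
    have : (1 - σ θ * σ (σ (σ θ))) * σ y = 0 := by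
      linear_combination g + σ θ * h0
    rcases mul_eq_zero.1 this with h | h
    · exact hB h
    · exact hy ((map_eq_zero σ).1 h)
  ext z
  constructor
  · rintro ⟨x, hx, rfl⟩
    refine ⟨σ x + θ * σ (σ (σ x)), hf0 x hx, ?_⟩
    have := hf0 x hx
    simp only [map_add, map_mul, h4]
    field_simp
    ring
  · rintro ⟨y, hy, rfl⟩
    refine ⟨(σ (σ (σ y)) - σ (σ (σ θ)) * σ y) / (1 - σ θ * σ (σ (σ θ))),
      div_ne_zero (hg0 y hy) hB, ?_⟩
    have hθ' : 1 - σ (σ θ) * θ ≠ 0 := by rwa [mul_comm]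
    have h5 : σ ((σ (σ (σ y)) - σ (σ (σ θ)) * σ y) / (1 - σ θ * σ (σ (σ θ)))) +
      θ * σ (σ (σ ((σ (σ (σ y)) - σ (σ (σ θ)) * σ y) / (1 - σ θ * σ (σ (σ θ)))))) = y := by
      simp only [map_sub, map_mul, map_div₀, map_one, h4]
      field_simp
      ring
    rw [h5]
    field_simp
    ring
end


/-- **The case `n = 4`: equivalence via the "inverse" map.**
Let `f(x) = x^q + θ x^{q³}` and `g(x) = x^q + δ x^{q³}` over `F_{q⁴}`, with
`N(θ), N(δ) ∉ {0,1}`.  There exists `c ∈ F_{q⁴}` with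
`{c·x/f(x) : x ≠ 0} = {g(x)/x : x ≠ 0}` iff `θ^{q²+1} ∈ {δ^{q²+1}, δ^{-(q³+q)}}`;
moreover, when this condition holds, the number of such `c` is exactly `q + 1`. -/
theorem LP_inverse_equivalence_n_four (p r q : ℕ) (hp : p.Prime) (hr : 0 < r)
    (hq : q = p ^ r)
    (F : Type*) [Field F] [Fintype F] (hF : Fintype.card F = q ^ 4)
    (θ δ : F)
    (hθ0 : θ ^ ((q ^ 4 - 1) / (q - 1)) ≠ 0) (hθ1 : θ ^ ((q ^ 4 - 1) / (q - 1)) ≠ 1)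
    (hδ0 : δ ^ ((q ^ 4 - 1) / (q - 1)) ≠ 0) (hδ1 : δ ^ ((q ^ 4 - 1) / (q - 1)) ≠ 1) :
    ((∃ c : F,
        {y : F | ∃ x : F, x ≠ 0 ∧ y = c * x / (x ^ q + θ * x ^ q ^ 3)} =
        {y : F | ∃ x : F, x ≠ 0 ∧ y = (x ^ q + δ * x ^ q ^ 3) / x}) ↔
      (θ ^ (q ^ 2 + 1) = δ ^ (q ^ 2 + 1) ∨ θ ^ (q ^ 2 + 1) = (δ ^ (q ^ 3 + q))⁻¹)) ∧
    ((θ ^ (q ^ 2 + 1) = δ ^ (q ^ 2 + 1) ∨ θ ^ (q ^ 2 + 1) = (δ ^ (q ^ 3 + q))⁻¹) →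
      {c : F |
        {y : F | ∃ x : F, x ≠ 0 ∧ y = c * x / (x ^ q + θ * x ^ q ^ 3)} =
        {y : F | ∃ x : F, x ≠ 0 ∧ y = (x ^ q + δ * x ^ q ^ 3) / x}}.ncard = q + 1) := by
  classical
  haveI : Fact p.Prime := ⟨hp⟩
  have hq2 : 2 ≤ q := by
    rw [hq]
    calc 2 ≤ p := hp.two_le
      _ ≤ p ^ r := Nat.le_self_pow hr.ne' p
  have hF' : Fintype.card F = p ^ (r * 4) := by rw [hF, hq, ← pow_mul]
  haveI : CharP F p := charP_of_card_eq_prime_pow hF'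
  haveI : ExpChar F p := ExpChar.prime hp
  obtain ⟨σ, hσ⟩ : ∃ σ : F →+* F, ∀ x, σ x = x ^ q :=
    ⟨iterateFrobenius F p r, fun x => by rw [iterateFrobenius_def, hq]⟩
  have h4 : ∀ x, σ (σ (σ (σ x))) = x := by
    intro x
    simp only [hσ, ← pow_mul]
    have := FiniteField.pow_card x
    rw [hF] at this
    conv_rhs => rw [← this]
    ring_nf
  have e3 : ∀ x : F, x ^ q ^ 3 = σ (σ (σ x)) := fun x => by
    simp only [hσ, ← pow_mul]; ring_nf
  have e2 : ∀ x : F, x ^ (q ^ 2 + 1) = x * σ (σ x) := fun x => by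
    simp only [hσ, ← pow_mul]; ring_nf
  have e31 : ∀ x : F, x ^ (q ^ 3 + q) = σ (x * σ (σ x)) := fun x => by
    simp only [map_mul, hσ, ← pow_mul]; ring_nf
  have hdiv : (q ^ 4 - 1) / (q - 1) = 1 + q + q ^ 2 + q ^ 3 := by
    rw [(aux_fact hq2).1]; exact Nat.mul_div_cancel_left _ (by omega)
  have eN : ∀ x : F, x ^ ((q ^ 4 - 1) / (q - 1)) = (x * σ (σ x)) * σ (x * σ (σ x)) := fun x => by
    rw [hdiv]; simp only [map_mul, hσ, ← pow_mul]; ring_nf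
  rw [eN] at hθ0 hθ1 hδ0 hδ1
  have hθ : θ ≠ 0 := by rintro rfl; simp at hθ0
  have hδ : δ ≠ 0 := by rintro rfl; simp at hδ0
  have hθA : 1 - θ * σ (σ θ) ≠ 0 := by
    intro h
    have : θ * σ (σ θ) = 1 := by linear_combination -h
    rw [this] at hθ1; simp at hθ1
  have hB : 1 - σ θ * σ (σ (σ θ)) ≠ 0 := by
    have := (map_ne_zero σ).2 hθA
    simpa using this
  have hσδ : σ δ ≠ 0 := (map_ne_zero σ).2 hδ
  have hη : - σ (σ θ) ≠ 0 := neg_ne_zero.2 ((map_ne_zero σ).2 ((map_ne_zero σ).2 hθ))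
  have hση : σ (- σ (σ θ)) ≠ 0 := (map_ne_zero σ).2 hη
  have hH : (- σ (σ θ)) * σ (σ (- σ (σ θ))) = θ * σ (σ θ) := by
    simp only [map_neg, h4]; ring
  have hset : ∀ c : F, {y : F | ∃ x : F, x ≠ 0 ∧ y = c * x / (x ^ q + θ * x ^ q ^ 3)} =
      auxL σ (c / (1 - σ θ * σ (σ (σ θ)))) (c / (1 - σ θ * σ (σ (σ θ))) * (- σ (σ θ))) := by
    intro c
    rw [← aux_inverse hq2 hF hσ h4 θ c hθA]
    simp only [e3, hσ]
  have hset' : {y : F | ∃ x : F, x ≠ 0 ∧ y = (x ^ q + δ * x ^ q ^ 3) / x} = auxL σ 1 δ := by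
    simp only [auxL, e3, hσ, one_mul]
  have hcond : (θ ^ (q ^ 2 + 1) = δ ^ (q ^ 2 + 1) ∨ θ ^ (q ^ 2 + 1) = (δ ^ (q ^ 3 + q))⁻¹) ↔
      ((- σ (σ θ)) * σ (σ (- σ (σ θ))) = δ * σ (σ δ) ∨
        ((- σ (σ θ)) * σ (σ (- σ (σ θ)))) * σ (δ * σ (σ δ)) = 1) := by
    rw [e2, e2, e31, hH]
    have hne : σ (δ * σ (σ δ)) ≠ 0 := right_ne_zero_of_mul hδ0
    rw [← one_div, eq_div_iff hne]
  rw [hcond]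
  simp only [hset, hset']
  generalize hηd : - σ (σ θ) = η at *
  generalize 1 - σ θ * σ (σ (σ θ)) = B at *
  -- the solutions are the roots of an explicit binomial
  have hsol : (η * σ (σ η) = δ * σ (σ δ) ∨ (η * σ (σ η)) * σ (δ * σ (σ δ)) = 1) →
      ∀ c : F, auxL σ (c / B) (c / B * η) = auxL σ 1 δ ↔
        c ^ (q + 1) = σ δ / σ η * B ^ (q + 1) := by
    intro hc c
    have hiff : c ^ (q + 1) = σ δ / σ η * B ^ (q + 1) ↔ c / B * σ (c / B) * σ η = σ δ := by
      have : c / B * σ (c / B) = c ^ (q + 1) / B ^ (q + 1) := by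
        rw [hσ, ← pow_succ', div_pow]
      rw [this]
      field_simp
    rw [hiff]
    exact ⟨fun h => (aux_necessity hp hF' hq2 hF hσ h4 _ η δ hη h).1,
      fun h => aux_suff hq2 hF hσ h4 _ η δ hη hδ h hc⟩
  have hroot : (η * σ (σ η) = δ * σ (σ δ) ∨ (η * σ (σ η)) * σ (δ * σ (σ δ)) = 1) →
      ∃ c : F, c ^ (q + 1) = σ δ / σ η * B ^ (q + 1) := by
    intro hc
    have hs : ∀ x : F, x ≠ 0 → σ x ≠ 0 := fun x hx => (map_ne_zero σ).2 hx
    obtain ⟨w, hw⟩ : ∃ w, w = (σ δ / σ η) ^ (q ^ 2 + 1) := ⟨_, rfl⟩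
    have hw0 : w ≠ 0 := by rw [hw]; exact pow_ne_zero _ (div_ne_zero hσδ hση)
    have hfix : σ w = w := by
      rw [hw, e2]
      have n0 := hη
      have n1 := hs _ n0
      have n2 := hs _ n1
      have n3 := hs _ n2
      have m1 := hs _ hδ
      have m2 := hs _ m1
      have m3 := hs _ m2
      rcases hc with hc | hc
      · have hc1 := congrArg σ hc
        simp only [map_mul, map_div₀, h4] at hc1 ⊢
        field_simp
        linear_combination (δ * σ (σ δ)) * hc1 - (σ δ * σ (σ (σ δ))) * hc
      · have hc1 := congrArg σ hc
        simp only [map_mul, map_div₀, h4, map_one] at hc hc1 ⊢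
        field_simp
        linear_combination hc1 - hc
    have hw1 : w ^ (q - 1) = 1 := by
      have : w ^ (q - 1) * w = 1 * w := by
        rw [← pow_succ, Nat.sub_add_cancel (by omega), ← hσ, hfix, one_mul]
      exact mul_right_cancel₀ hw0 this
    rw [hw, ← pow_mul] at hw1
    obtain ⟨v, hv⟩ := aux_root hq2 hF _ _ (aux_fact hq2).2 _ hw1
    exact ⟨v * B, by rw [mul_pow, hv]⟩
  refine ⟨⟨?_, ?_⟩, ?_⟩
  · rintro ⟨c, hc⟩
    exact (aux_necessity hp hF' hq2 hF hσ h4 _ η δ hη hc).2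
  · intro hc
    obtain ⟨c, h⟩ := hroot hc
    exact ⟨c, (hsol hc c).2 h⟩
  · intro hc
    simp only [hsol hc]
    obtain ⟨ζ, hζ, -⟩ := aux_gen (F := F) hq2 hF
    have hpos : 0 < q ^ 4 - 1 := by
      have := Nat.pow_le_pow_left hq2 4
      omega
    have hζ' := hζ.pow hpos ((aux_fact hq2).2.trans (mul_comm _ _))
    have hne : σ δ / σ η * B ^ (q + 1) ≠ 0 :=
      mul_ne_zero (div_ne_zero hσδ hση) (pow_ne_zero _ hB)
    have hcard := hζ'.card_nthRoots (σ δ / σ η * B ^ (q + 1))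
    rw [if_pos (hroot hc)] at hcard
    have hnd := hζ'.nthRoots_nodup hne
    have : {c : F | c ^ (q + 1) = σ δ / σ η * B ^ (q + 1)} =
        ((Polynomial.nthRoots (q + 1) (σ δ / σ η * B ^ (q + 1))).toFinset : Set F) := by
      ext c
      simp [Polynomial.mem_nthRoots]
    rw [this, Set.ncard_coe_finset, Multiset.toFinset_card_of_nodup hnd, hcard]
end
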